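/- arXiv:0810.4074 — 3 statements merged into one kernel-verified Lean document; each statement's English description precedes it below -/
import Mathlib

section
/- Let n ≥ 2 and let < and <' be left-invariant total orderings of the braid group B_n. If < and <' are conjugate, then there exists a conjugating element between < and <' that lies in the positive braid monoid B_n^+. -/
/-! ## The braid group and the positive braid monoid -/

/-- The braid relations on `m` generators `σ_1, …, σ_m` (indexed by `Fin m`). -/
def braidRels (m : ℕ) : Set (FreeGroup (Fin m)) :=
  {x | (∃ i j : Fin m, (i : ℕ) + 2 ≤ (j : ℕ) ∧
          x = FreeGroup.of i * FreeGroup.of j * (FreeGroup.of i)⁻¹ * (FreeGroup.of j)⁻¹) ∨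
       (∃ i j : Fin m, (j : ℕ) = (i : ℕ) + 1 ∧
          x = FreeGroup.of i * FreeGroup.of j * FreeGroup.of i *
              (FreeGroup.of j * FreeGroup.of i * FreeGroup.of j)⁻¹)}

/-- The braid group `B_n`, presented with `n-1` Artin generators. -/
abbrev BraidGroup (n : ℕ) := PresentedGroup (braidRels (n - 1))

/-- The Artin generator `σ_i` (1-based index `i`) of `B_n`. -/
def sig (n i : ℕ) : BraidGroup n :=
  if h : i - 1 < n - 1 then PresentedGroup.of (⟨i - 1, h⟩ : Fin (n - 1)) else 1

/-- The positive braid monoid `B_n^+`, the submonoid generated by the `σ_i`. -/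
def posMonoid (n : ℕ) : Submonoid (BraidGroup n) :=
  Submonoid.closure (Set.range fun i : Fin (n - 1) => (PresentedGroup.of i : BraidGroup n))

/-- Evaluation of a positive word (letters are 1-based generator indices) in `B_n`. -/
def wordEval (n : ℕ) (l : List ℕ) : BraidGroup n := (l.map (sig n)).prod

section BraidSequence

variable {G : Type*} [Group G]

/-- The element `s (k-1) ⋯ s 1 * s 0 * s 0 * s 1 ⋯ s (k-1)`. -/
def jucysMurphy (s : ℕ → G) : ℕ → G
  | 0 => 1
  | k + 1 => s k * jucysMurphy s k * s k

/-- The full twist on the first `k` generators, as a product of Jucys–Murphy elements. -/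
def fullTwist (s : ℕ → G) : ℕ → G
  | 0 => 1
  | k + 1 => fullTwist s k * jucysMurphy s (k + 1)

variable {s : ℕ → G} {m : ℕ}

theorem commute_jucysMurphy_of_lt (hc : ∀ i j, i + 2 ≤ j → j < m → Commute (s i) (s j))
    {k j : ℕ} (hkj : k < j) (hj : j < m) : Commute (jucysMurphy s k) (s j) := by
  induction k with
  | zero => exact Commute.one_left _
  | succ k ih =>
    have h := hc k j (by omega) hj
    exact (h.mul_left (ih (by omega))).mul_left h

theorem commute_fullTwist_of_lt (hc : ∀ i j, i + 2 ≤ j → j < m → Commute (s i) (s j))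
    {k j : ℕ} (hkj : k < j) (hj : j < m) : Commute (fullTwist s k) (s j) := by
  induction k with
  | zero => exact Commute.one_left _
  | succ k ih => exact (ih (by omega)).mul_left (commute_jucysMurphy_of_lt hc hkj hj)

theorem commute_jucysMurphy_of_succ_lt (hc : ∀ i j, i + 2 ≤ j → j < m → Commute (s i) (s j))
    (hb : ∀ i, i + 1 < m → s i * s (i + 1) * s i = s (i + 1) * s i * s (i + 1))
    {k i : ℕ} (hik : i + 1 < k) (hk : k ≤ m) : Commute (jucysMurphy s k) (s i) := by
  induction k with
  | zero => omega
  | succ k ih =>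
    rcases Nat.lt_or_ge (i + 1) k with h | h
    · have hs := (hc i k (by omega) (by omega)).symm
      exact (hs.mul_left (ih h (by omega))).mul_left hs
    · obtain rfl : k = i + 1 := by omega
      have hbr := hb i (by omega)
      have ha : Commute (jucysMurphy s i) (s (i + 1)) :=
        commute_jucysMurphy_of_lt hc (by omega) (by omega)
      simp only [jucysMurphy]
      generalize jucysMurphy s i = a at *
      generalize s (i + 1) = u at *
      generalize s i = t at *
      change u * (t * a * t) * u * t = t * (u * (t * a * t) * u)
      calc u * (t * a * t) * u * t = u * t * a * (t * u * t) := by group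
        _ = u * t * (a * u) * t * u := by rw [hbr]; group
        _ = (u * t * u) * a * t * u := by rw [ha.eq]; group
        _ = t * (u * (t * a * t) * u) := by rw [← hbr]; group

theorem commute_jucysMurphy_jucysMurphy
    (hc : ∀ i j, i + 2 ≤ j → j < m → Commute (s i) (s j))
    (hb : ∀ i, i + 1 < m → s i * s (i + 1) * s i = s (i + 1) * s i * s (i + 1))
    {k l : ℕ} (hl : l < k) (hk : k ≤ m) :
    Commute (jucysMurphy s k) (jucysMurphy s l) := by
  induction l with
  | zero => exact Commute.one_right _
  | succ l ih =>
    have h := commute_jucysMurphy_of_succ_lt hc hb hl hk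
    exact (h.mul_right (ih (by omega))).mul_right h

theorem commute_fullTwist (hc : ∀ i j, i + 2 ≤ j → j < m → Commute (s i) (s j))
    (hb : ∀ i, i + 1 < m → s i * s (i + 1) * s i = s (i + 1) * s i * s (i + 1))
    {k i : ℕ} (hik : i < k) (hk : k ≤ m) : Commute (fullTwist s k) (s i) := by
  induction k with
  | zero => omega
  | succ k ih =>
    rcases Nat.lt_or_ge i k with h | h
    · exact (ih h (by omega)).mul_left (commute_jucysMurphy_of_succ_lt hc hb (by omega) hk)
    · obtain rfl : i = k := by omega
      cases i with
      | zero =>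
        simp only [fullTwist, jucysMurphy, one_mul, mul_one]
        exact (Commute.refl _).mul_left (Commute.refl _)
      | succ i =>
        have hz : Commute (fullTwist s i) (s (i + 1)) :=
          commute_fullTwist_of_lt hc (by omega) (by omega)
        have hA := commute_jucysMurphy_jucysMurphy hc hb (Nat.lt_succ_self (i + 1)) hk
        rw [fullTwist, fullTwist, mul_assoc]
        refine hz.mul_left ?_
        rw [jucysMurphy.eq_def s (i + 1 + 1)] at hA ⊢
        dsimp only at hA ⊢
        generalize jucysMurphy s (i + 1) = a at *
        generalize s (i + 1) = u at *
        change a * (u * a * u) * u = u * (a * (u * a * u))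
        calc a * (u * a * u) * u = u * a * u * a * u := congrArg (· * u) hA.eq.symm
          _ = u * (a * (u * a * u)) := by group

theorem jucysMurphy_mem {P : Submonoid G} (hP : ∀ i, s i ∈ P) (k : ℕ) :
    jucysMurphy s k ∈ P := by
  induction k with
  | zero => exact P.one_mem
  | succ k ih => exact P.mul_mem (P.mul_mem (hP k) ih) (hP k)

theorem fullTwist_mem {P : Submonoid G} (hP : ∀ i, s i ∈ P) (k : ℕ) : fullTwist s k ∈ P := by
  induction k with
  | zero => exact P.one_mem
  | succ k ih => exact P.mul_mem ih (jucysMurphy_mem hP (k + 1))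

theorem inv_mul_fullTwist_mem (hc : ∀ i j, i + 2 ≤ j → j < m → Commute (s i) (s j))
    (hb : ∀ i, i + 1 < m → s i * s (i + 1) * s i = s (i + 1) * s i * s (i + 1))
    {P : Submonoid G} (hP : ∀ i, s i ∈ P) {k i : ℕ} (hik : i < k) (hk : k ≤ m) :
    (s i)⁻¹ * fullTwist s k ∈ P := by
  induction k with
  | zero => omega
  | succ k ih =>
    rcases Nat.lt_or_ge i k with h | h
    · rw [fullTwist, ← mul_assoc]
      exact P.mul_mem (ih h (by omega)) (jucysMurphy_mem hP (k + 1))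
    · obtain rfl : i = k := by omega
      rw [← (commute_fullTwist hc hb hik hk).inv_right.eq]
      simp only [fullTwist, jucysMurphy, mul_assoc, mul_inv_cancel, mul_one]
      exact P.mul_mem (fullTwist_mem hP i) (P.mul_mem (hP i) (jucysMurphy_mem hP i))

end BraidSequence

/-- If every inverse of an element of a generating set `S` becomes positive after multiplication
by the central element `z`, then every group element does after multiplication by some
central element. -/
theorem exists_mem_center_mul_mem_closure {G : Type*} [Group G] {S : Set G}
    (hS : Subgroup.closure S = ⊤) {z : G} (hz : z ∈ Subgroup.center G)
    (hinv : ∀ x ∈ S, x⁻¹ * z ∈ Submonoid.closure S) (g : G) :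
    ∃ c ∈ Subgroup.center G, g * c ∈ Submonoid.closure S := by
  have mul_aux : ∀ x y : G,
      (∃ c ∈ Subgroup.center G, x * c ∈ Submonoid.closure S) →
      (∃ c ∈ Subgroup.center G, y * c ∈ Submonoid.closure S) →
      ∃ c ∈ Subgroup.center G, x * y * c ∈ Submonoid.closure S := by
    rintro x y ⟨c, hc, hx⟩ ⟨d, hd, hy⟩
    refine ⟨c * d, mul_mem hc hd, ?_⟩
    have h := mul_mem hx hy
    rwa [mul_assoc, ← mul_assoc c, ← Subgroup.mem_center_iff.mp hc y, mul_assoc y,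
      ← mul_assoc] at h
  have key : (∃ c ∈ Subgroup.center G, g * c ∈ Submonoid.closure S) ∧
      ∃ c ∈ Subgroup.center G, g⁻¹ * c ∈ Submonoid.closure S := by
    have hg : g ∈ Subgroup.closure S := hS ▸ Subgroup.mem_top g
    induction hg using Subgroup.closure_induction with
    | mem x hx =>
      exact ⟨⟨1, one_mem _, by simpa using Submonoid.subset_closure hx⟩, z, hz, hinv x hx⟩
    | one => exact ⟨⟨1, one_mem _, by simp⟩, 1, one_mem _, by simp⟩
    | mul x y _ _ hx hy =>
      exact ⟨mul_aux x y hx.1 hy.1, by simpa using mul_aux _ _ hy.2 hx.2⟩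
    | inv x _ hx => exact ⟨hx.2, by simpa using hx.1⟩
  exact key.1

theorem sig_succ (n : ℕ) (i : Fin (n - 1)) : sig n (i + 1) = PresentedGroup.of i := by
  simp [sig]

theorem sig_mem_posMonoid (n i : ℕ) : sig n i ∈ posMonoid n := by
  unfold sig
  split_ifs with h
  · exact Submonoid.subset_closure ⟨_, rfl⟩
  · exact one_mem _

theorem commute_sig (n i j : ℕ) (hij : i + 2 ≤ j) (hj : j < n - 1) :
    Commute (sig n (i + 1)) (sig n (j + 1)) := by
  have h := PresentedGroup.one_of_mem (rels := braidRels (n - 1))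
    (Or.inl ⟨⟨i, by omega⟩, ⟨j, hj⟩, hij, rfl⟩)
  rw [sig_succ n ⟨i, by omega⟩, sig_succ n ⟨j, hj⟩]
  simp only [map_mul, map_inv] at h
  exact eq_mul_of_mul_inv_eq (mul_inv_eq_one.mp h)

theorem sig_braid (n i : ℕ) (hi : i + 1 < n - 1) :
    sig n (i + 1) * sig n (i + 1 + 1) * sig n (i + 1) =
      sig n (i + 1 + 1) * sig n (i + 1) * sig n (i + 1 + 1) := by
  have h := PresentedGroup.one_of_mem (rels := braidRels (n - 1))
    (Or.inr ⟨⟨i, by omega⟩, ⟨i + 1, hi⟩, rfl, rfl⟩)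
  rw [sig_succ n ⟨i, by omega⟩, sig_succ n ⟨i + 1, hi⟩]
  rw [map_mul, map_inv] at h
  simp only [map_mul] at h
  exact mul_inv_eq_one.mp h

theorem fullTwist_mem_center (n : ℕ) :
    fullTwist (fun i => sig n (i + 1)) (n - 1) ∈ Subgroup.center (BraidGroup n) := by
  have h : Subgroup.closure (Set.range (PresentedGroup.of (rels := braidRels (n - 1)))) ≤
      Subgroup.centralizer {fullTwist (fun i => sig n (i + 1)) (n - 1)} := by
    rw [Subgroup.closure_le]
    rintro _ ⟨i, rfl⟩
    rw [SetLike.mem_coe, Subgroup.mem_centralizer_singleton_iff, ← sig_succ]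
    exact (commute_fullTwist (s := fun i => sig n (i + 1)) (commute_sig n) (sig_braid n)
      i.2 le_rfl).symm.eq
  rw [PresentedGroup.closure_range_of] at h
  exact Subgroup.mem_center_iff.mpr fun g =>
    Subgroup.mem_centralizer_singleton_iff.mp (h (Subgroup.mem_top g))

theorem exists_mem_center_mul_mem_posMonoid (n : ℕ) (g : BraidGroup n) :
    ∃ c ∈ Subgroup.center (BraidGroup n), g * c ∈ posMonoid n := by
  refine exists_mem_center_mul_mem_closure (PresentedGroup.closure_range_of _)
    (fullTwist_mem_center n) ?_ g
  rintro _ ⟨i, rfl⟩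
  rw [← sig_succ]
  exact inv_mul_fullTwist_mem (s := fun i => sig n (i + 1)) (commute_sig n) (sig_braid n)
    (fun i => sig_mem_posMonoid n (i + 1)) i.2 le_rfl

/-- If two left-invariant total orderings of the braid group `B_n` are
conjugate, then a conjugating element can be chosen in the positive braid monoid. -/
theorem conjugating_element_can_be_chosen_positive
    (n : ℕ) (hn : 2 ≤ n) (lt lt' : BraidGroup n → BraidGroup n → Prop)
    (hto : IsStrictTotalOrder (BraidGroup n) lt)
    (hto' : IsStrictTotalOrder (BraidGroup n) lt')
    (hinv : ∀ a b c : BraidGroup n, lt a b → lt (c * a) (c * b))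
    (hinv' : ∀ a b c : BraidGroup n, lt' a b → lt' (c * a) (c * b))
    (hconj : ∃ g : BraidGroup n, ∀ f h : BraidGroup n, lt f h ↔ lt' (f * g) (h * g)) :
    ∃ g ∈ posMonoid n, ∀ f h : BraidGroup n, lt f h ↔ lt' (f * g) (h * g) := by
  obtain ⟨g, hg⟩ := hconj
  obtain ⟨c, hc, hgc⟩ := exists_mem_center_mul_mem_posMonoid n g
  refine ⟨g * c, hgc, fun f h => ?_⟩
  rw [← mul_assoc, ← mul_assoc, Subgroup.mem_center_iff.mp hc, Subgroup.mem_center_iff.mp hc, hg]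
  exact ⟨hinv' _ _ c, fun H => by simpa using hinv' _ _ c⁻¹ H⟩
end

section
/- Let n ≥ 2 and let < be a left-invariant total ordering of B_n satisfying Property S. Then the restriction of < to the positive braid monoid B_n^+ is a well-ordering, i.e., every nonempty subset of B_n^+ has a <-least element. -/
/-- Property `S` of an ordering of `B_n`:
`α σ_i β > α β > α σ_i⁻¹ β` for all `α, β` and all `1 ≤ i ≤ n-1`. -/
def PropertyS (n : ℕ) (lt : BraidGroup n → BraidGroup n → Prop) : Prop :=
  ∀ (α β : BraidGroup n) (i : ℕ), 1 ≤ i → i ≤ n - 1 →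
    lt (α * β) (α * sig n i * β) ∧ lt (α * (sig n i)⁻¹ * β) (α * β)

/-- In a preordered monoid with monotone left multiplication, let `g` be a family of elements such
that left multiplication by each `g i` is inflationary. If a word embeds in another one, then the
products are ordered accordingly. -/
theorem prod_map_le_of_sublistForall₂ {ι M : Type*} [Monoid M] [Preorder M] [MulLeftMono M]
    {g : ι → M} (hg : ∀ i b, b ≤ g i * b) {u v : List ι}
    (h : List.SublistForall₂ (· = ·) u v) : (u.map g).prod ≤ (v.map g).prod := by
  induction h with
  | @nil l =>
    induction l with
    | nil => rfl
    | cons i l ih => simpa using ih.trans (hg i _)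
  | cons hij _ ih =>
    subst hij
    simpa using mul_le_mul_right ih _
  | cons_right _ ih => simpa using ih.trans (hg _ _)

/-- A submonoid generated by finitely many elements with inflationary left multiplication is
partially well-ordered, by Higman's lemma. -/
theorem isPWO_closure_range {ι M : Type*} [Finite ι] [Monoid M] [Preorder M] [MulLeftMono M]
    {g : ι → M} (hg : ∀ i b, b ≤ g i * b) :
    (Submonoid.closure (Set.range g) : Set M).IsPWO := by
  have higman := Set.PartiallyWellOrderedOn.partiallyWellOrderedOn_sublistForall₂
    (· = · : ι → ι → Prop) (s := Set.univ) (Set.finite_univ.partiallyWellOrderedOn)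
  refine (higman.image_of_monotone_on (r' := (· ≤ ·)) (f := fun l => (l.map g).prod)
    fun u _ v _ h => prod_map_le_of_sublistForall₂ hg h).mono ?_
  intro x hx
  induction hx using Submonoid.closure_induction_left with
  | one => exact ⟨[], by simp, by simp⟩
  | mul_left y hy z _ ih =>
    obtain ⟨i, rfl⟩ := hy
    obtain ⟨l, -, rfl⟩ := ih
    exact ⟨i :: l, by simp, by simp⟩

/-- A left-invariant total ordering of `B_n` with Property `S`
restricts to a well-ordering on the positive braid monoid `B_n^+`. -/
theorem propertyS_wellorders_positive_monoid
    (n : ℕ) (hn : 2 ≤ n) (lt : BraidGroup n → BraidGroup n → Prop)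
    (hto : IsStrictTotalOrder (BraidGroup n) lt)
    (hinv : ∀ a b c : BraidGroup n, lt a b → lt (c * a) (c * b))
    (hS : PropertyS n lt) :
    ∀ S : Set (BraidGroup n), S ⊆ (posMonoid n : Set (BraidGroup n)) → S.Nonempty →
      ∃ a ∈ S, ∀ b ∈ S, a = b ∨ lt a b := by
  classical
  let _ : LinearOrder (BraidGroup n) := linearOrderOfSTO lt
  have : MulLeftMono (BraidGroup n) :=
    ⟨fun c a b h => h.elim (fun e => Or.inl (by rw [e])) fun h => Or.inr (hinv a b c h)⟩
  have infl : ∀ (i : Fin (n - 1)) (b : BraidGroup n), b ≤ PresentedGroup.of i * b := by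
    intro i b
    have h := (hS 1 b (i + 1) (by omega) (by omega)).1
    simp only [sig, Nat.add_sub_cancel, i.isLt, dite_true, Fin.eta, one_mul] at h
    exact Or.inr h
  intro S hS ⟨x, hx⟩
  have wf : S.IsWF := ((isPWO_closure_range infl).mono hS).isWF
  exact ⟨wf.min ⟨x, hx⟩, wf.min_mem _, fun b hb => wf.min_le _ hb⟩
end

section
/- For every n ≥ 2, the Dehornoy ordering <_D of B_n satisfies Property S: for all α, β ∈ B_n and all 1 ≤ i ≤ n-1, ασ_iβ >_D αβ >_D ασ_i^{-1}β. -/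
/-- Evaluation of a signed braid word: the letter `(i, true)` is `σ_i` and
`(i, false)` is `σ_i⁻¹`. -/
def sEval (n : ℕ) (l : List (ℕ × Bool)) : BraidGroup n :=
  (l.map fun p => if p.2 then sig n p.1 else (sig n p.1)⁻¹).prod

/-- The Dehornoy ordering of `B_n`: `α <_D β` iff for some `1 ≤ i ≤ n-1` the braid
`α⁻¹β` admits a signed word representative containing at least one `σ_i`, but containing
no letter `σ_j^{±1}` with `j < i` and no letter `σ_i⁻¹`. -/
def dehornoyLt (n : ℕ) (α β : BraidGroup n) : Prop :=
  ∃ i : ℕ, 1 ≤ i ∧ i ≤ n - 1 ∧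
    ∃ l : List (ℕ × Bool), sEval n l = α⁻¹ * β ∧
      (∀ p ∈ l, i ≤ p.1 ∧ p.1 ≤ n - 1) ∧ (i, false) ∉ l ∧ (i, true) ∈ l

/-! ## Graphs with braid-like edges -/

namespace BraidOrder

/-- Two generator indices are far apart when their generators commute. -/
def Far (i j : ℕ) : Prop := i + 2 ≤ j ∨ j + 2 ≤ i

/-- Two generator indices are near when their generators braid. -/
def Near (i j : ℕ) : Prop := j = i + 1 ∨ i = j + 1

theorem Far.symm {i j : ℕ} (h : Far i j) : Far j i := Or.symm h

theorem Near.symm {i j : ℕ} (h : Near i j) : Near j i := Or.symm h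

theorem eq_or_far_or_near (i j : ℕ) : i = j ∨ Far i j ∨ Near i j := by
  unfold Far Near; omega

/-- A graph whose edges, labelled by generator indices, satisfy the local closure
properties of the graph of divisors of a power of the fundamental braid. -/
structure BraidGraph {V : Type*} (E : ℕ → V → V → Prop) (m : ℕ) : Prop where
  bound : ∀ {i x y}, E i x y → i < m
  det : ∀ {i x y z}, E i x y → E i x z → y = z
  codet : ∀ {i y z t}, E i y t → E i z t → y = z
  far_up : ∀ {i j x y z}, Far i j → E i x y → E j x z → ∃ t, E j y t ∧ E i z t
  far_down : ∀ {i j y z t}, Far i j → E i y t → E j z t → ∃ x, E i x z ∧ E j x y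
  far_swap : ∀ {i j x y z}, Far i j → E i x y → E j y z → ∃ y', E j x y' ∧ E i y' z
  near_up : ∀ {i j x y z}, Near i j → E i x y → E j x z →
    ∃ y' z' t, E j y y' ∧ E i y' t ∧ E i z z' ∧ E j z' t
  near_down : ∀ {i j y z t}, Near i j → E i y t → E j z t →
    ∃ x y' z', E i x y' ∧ E j y' y ∧ E j x z' ∧ E i z' z

section Paths

variable {V : Type*} (E : ℕ → V → V → Prop)

/-- An edge of level at least `k`, traversed in either direction. -/
def Lev (k : ℕ) (x y : V) : Prop := ∃ i, k ≤ i ∧ (E i x y ∨ E i y x)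

/-- Connectedness by edges of level at least `k`. -/
def Conn (k : ℕ) : V → V → Prop := Relation.ReflTransGen (Lev E k)

/-- A forward edge of level `k`, or an edge of level greater than `k` in either direction. -/
def Up (k : ℕ) (x y : V) : Prop := E k x y ∨ Lev E (k + 1) x y

/-- The existence of a path all of whose edges of level `k` are traversed forwards. -/
def UpPath (k : ℕ) : V → V → Prop := Relation.ReflTransGen (Up E k)

/-- The existence of an `UpPath` with at least one edge of level `k`. -/
def Strict (k : ℕ) (x y : V) : Prop := ∃ a b, UpPath E k x a ∧ E k a b ∧ UpPath E k b y

/-- The opposite graph. -/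
def Op (i : ℕ) (x y : V) : Prop := E i y x

variable {E}

theorem Lev.symm {k : ℕ} {x y : V} : Lev E k x y → Lev E k y x :=
  fun ⟨i, hi, h⟩ => ⟨i, hi, h.symm⟩

theorem Conn.symm {k : ℕ} {x y : V} (h : Conn E k x y) : Conn E k y x :=
  have : Std.Symm (Lev E k) := ⟨fun _ _ => Lev.symm⟩
  Relation.ReflTransGen.stdSymm.symm _ _ h

theorem Conn.upPath {k : ℕ} {x y : V} (h : Conn E (k + 1) x y) : UpPath E k x y :=
  Relation.ReflTransGen.mono (fun _ _ h => Or.inr h) _ _ h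

theorem upPath_of_lev {k i : ℕ} {x y : V} (hi : k + 1 ≤ i) (h : E i x y ∨ E i y x) :
    UpPath E k x y := .single (Or.inr ⟨i, hi, h⟩)

theorem upPath_of_edge {k : ℕ} {x y : V} (h : E k x y) : UpPath E k x y := .single (Or.inl h)

theorem UpPath.trans {k : ℕ} {x y z : V} (h : UpPath E k x y) (h' : UpPath E k y z) :
    UpPath E k x z := Relation.ReflTransGen.trans h h'

theorem UpPath.conn_or_edge {k : ℕ} {u v : V} (h : UpPath E k u v) :
    Conn E (k + 1) u v ∨ ∃ u' p, UpPath E k u u' ∧ E k u' p ∧ Conn E (k + 1) p v := by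
  induction h with
  | refl => exact Or.inl .refl
  | tail hab hbc ih =>
    rcases hbc with hbc | hbc
    · exact Or.inr ⟨_, _, hab, hbc, .refl⟩
    · rcases ih with ih | ⟨u', p, h1, h2, h3⟩
      · exact Or.inl (ih.tail hbc)
      · exact Or.inr ⟨u', p, h1, h2, h3.tail hbc⟩

theorem Strict.trans {k : ℕ} {x y z : V} (h : Strict E k x y) (h' : Strict E k y z) :
    Strict E k x z := by
  obtain ⟨a, b, h1, h2, h3⟩ := h
  obtain ⟨c, d, h4, h5, h6⟩ := h'
  exact ⟨a, b, h1, h2, h3.trans (h4.trans ((upPath_of_edge h5).trans h6))⟩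

theorem lev_op {k : ℕ} {x y : V} : Lev (Op E) k x y ↔ Lev E k x y := by
  simp only [Lev, Op, or_comm]

theorem conn_op {k : ℕ} {x y : V} : Conn (Op E) k x y ↔ Conn E k x y := by
  have : Lev (Op E) k = Lev E k := by ext; exact lev_op
  simp only [Conn, this]

theorem upPath_op {k : ℕ} {x y : V} : UpPath (Op E) k x y ↔ UpPath E k y x := by
  have : Up (Op E) k = Function.swap (Up E k) := by
    ext a b
    simp only [Up, Function.swap, lev_op, Op]
    exact or_congr Iff.rfl ⟨Lev.symm, Lev.symm⟩
  simp only [UpPath, this, Relation.reflTransGen_swap]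

theorem strict_op {k : ℕ} {x y : V} : Strict (Op E) k x y ↔ Strict E k y x := by
  simp only [Strict, upPath_op, Op]
  exact ⟨fun ⟨a, b, h1, h2, h3⟩ => ⟨b, a, h3, h2, h1⟩,
    fun ⟨a, b, h1, h2, h3⟩ => ⟨b, a, h3, h2, h1⟩⟩

end Paths

namespace BraidGraph

variable {V : Type*} {E : ℕ → V → V → Prop} {m : ℕ}

theorem op (hE : BraidGraph E m) : BraidGraph (Op E) m where
  bound h := hE.bound h
  det h h' := hE.codet h h'
  codet h h' := hE.det h h'
  far_up hf h h' :=
    let ⟨x, h1, h2⟩ := hE.far_down hf h h'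
    ⟨x, h2, h1⟩
  far_down hf h h' :=
    let ⟨x, h1, h2⟩ := hE.far_up hf h h'
    ⟨x, h2, h1⟩
  far_swap hf h h' :=
    let ⟨x, h1, h2⟩ := hE.far_swap hf.symm h' h
    ⟨x, h2, h1⟩
  near_up hf h h' :=
    let ⟨x, y', z', h1, h2, h3, h4⟩ := hE.near_down hf h h'
    ⟨y', z', x, h2, h1, h4, h3⟩
  near_down hf h h' :=
    let ⟨y', z', t, h1, h2, h3, h4⟩ := hE.near_up hf h h'
    ⟨t, y', z', h2, h1, h4, h3⟩

theorem lift (hE : BraidGraph E m) {k : ℕ} {p q w : V} (hpq : UpPath E (k + 1) p q)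
    (hw : E k w q) : ∃ u, E k u p ∧ UpPath E k u w := by
  induction hpq using Relation.ReflTransGen.head_induction_on with
  | refl => exact ⟨w, hw, .refl⟩
  | head hab _ ih =>
    obtain ⟨u', hu', hQ⟩ := ih
    rcases hab with hab | ⟨i, hi, hab | hab⟩
    · obtain ⟨x, y', z', h1, h2, h3, h4⟩ := hE.near_down (Or.inr rfl) hab hu'
      exact ⟨y', h2, (upPath_of_lev le_rfl (Or.inr h1)).trans
        ((upPath_of_edge h3).trans ((upPath_of_lev le_rfl (Or.inl h4)).trans hQ))⟩
    · obtain ⟨x, h1, h2⟩ := hE.far_down (Or.inr hi) hab hu'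
      exact ⟨x, h2, (upPath_of_lev (by omega) (Or.inl h1)).trans hQ⟩
    · obtain ⟨y', h1, h2⟩ := hE.far_swap (Or.inl hi) hu' hab
      exact ⟨y', h2, (upPath_of_lev (by omega) (Or.inr h1)).trans hQ⟩

theorem confluent [Finite V] (hE : BraidGraph E m) {k : ℕ} (hirr : ∀ x, ¬ Strict E k x x)
    (htot : ∀ {x y}, Conn E (k + 1) x y → UpPath E (k + 1) x y ∨ UpPath E (k + 1) y x)
    {u v w : V} (hu : UpPath E k u v) (hw : UpPath E k w v) :
    UpPath E k u w ∨ UpPath E k w u := by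
  have : IsTrans V (Strict E k) := ⟨fun _ _ _ => Strict.trans⟩
  have : Std.Irrefl (Strict E k) := ⟨hirr⟩
  have wf : WellFounded (Strict E k) := Finite.wellFounded_of_trans_of_irrefl _
  induction v using wf.induction generalizing u w with
  | _ v ih =>
    rcases hu.conn_or_edge with hc | ⟨u', p, h1, h2, h3⟩
    · exact Or.inr (hw.trans hc.symm.upPath)
    rcases hw.conn_or_edge with hc | ⟨w', q, h4, h5, h6⟩
    · exact Or.inl (hu.trans hc.symm.upPath)
    rcases htot (h3.trans h6.symm) with h | h
    · obtain ⟨x, hx, hxw⟩ := hE.lift h h5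
      obtain rfl := hE.codet hx h2
      exact ih w' ⟨w', q, .refl, h5, h6.upPath⟩ (h1.trans hxw) h4
    · obtain ⟨x, hx, hxw⟩ := hE.lift h h2
      obtain rfl := hE.codet hx h5
      exact ih u' ⟨u', p, .refl, h2, h3.upPath⟩ h1 (h4.trans hxw)

theorem eq_of_conn (hE : BraidGraph E m) {k : ℕ} (hk : m ≤ k) {x y : V} (h : Conn E k x y) :
    x = y := by
  induction h with
  | refl => rfl
  | tail _ h _ =>
    obtain ⟨i, hi, h | h⟩ := h <;> have := hE.bound h <;> omega

theorem total [Finite V] (hE : BraidGraph E m) (hirr : ∀ k x, ¬ Strict E k x x) (d k : ℕ)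
    (hk : m ≤ k + d) {x y : V} (h : Conn E k x y) : UpPath E k x y ∨ UpPath E k y x := by
  induction d generalizing k x y with
  | zero => exact Or.inl (hE.eq_of_conn hk h ▸ .refl)
  | succ d ih =>
    have htot : ∀ {x y}, Conn E (k + 1) x y → UpPath E (k + 1) x y ∨ UpPath E (k + 1) y x :=
      fun h => ih (k + 1) (by omega) h
    induction h with
    | refl => exact Or.inl .refl
    | @tail b c _ hbc ihh =>
      obtain ⟨i, hi, hbc⟩ := hbc
      rcases Nat.lt_or_eq_of_le hi with hi | rfl
      · rcases ihh with h | h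
        · exact Or.inl (h.trans (upPath_of_lev hi hbc))
        · exact Or.inr ((upPath_of_lev hi hbc.symm).trans h)
      · rcases ihh with h | h <;> rcases hbc with hbc | hbc
        · exact Or.inl (h.trans (upPath_of_edge hbc))
        · exact hE.confluent (hirr k) htot h (upPath_of_edge hbc)
        · have := hE.op.confluent (k := k) (fun x hx => hirr k x (strict_op.1 hx))
            (fun h => by simpa only [upPath_op] using (htot (conn_op.1 h)).symm)
            (upPath_op.2 h) (upPath_op.2 (upPath_of_edge hbc))
          simpa only [upPath_op, or_comm] using this
        · exact Or.inr ((upPath_of_edge hbc).trans h)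

theorem eq_or_strict [Finite V] (hE : BraidGraph E m) (hirr : ∀ k x, ¬ Strict E k x x)
    (d k : ℕ) (hk : m ≤ k + d) {x y : V} (h : Conn E k x y) :
    x = y ∨ ∃ i, Strict E i x y ∨ Strict E i y x := by
  induction d generalizing k with
  | zero => exact Or.inl (hE.eq_of_conn hk h)
  | succ d ih =>
    rcases hE.total hirr _ k hk h with h | h <;> rcases h.conn_or_edge with h | ⟨a, b, h1, h2, h3⟩
    · exact ih (k + 1) (by omega) h
    · exact Or.inr ⟨k, Or.inl ⟨a, b, h1, h2, h3.upPath⟩⟩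
    · exact ih (k + 1) (by omega) h.symm
    · exact Or.inr ⟨k, Or.inr ⟨a, b, h1, h2, h3.upPath⟩⟩

end BraidGraph

/-! ## The positive braid monoid -/

/-- The braid relations between positive words. -/
inductive BraidStep (m : ℕ) : FreeMonoid (Fin m) → FreeMonoid (Fin m) → Prop
  | comm (i j : Fin m) (h : Far i j) :
      BraidStep m (FreeMonoid.of i * FreeMonoid.of j) (FreeMonoid.of j * FreeMonoid.of i)
  | braid (i j : Fin m) (h : Near i j) :
      BraidStep m (FreeMonoid.of i * (FreeMonoid.of j * FreeMonoid.of i))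
        (FreeMonoid.of j * (FreeMonoid.of i * FreeMonoid.of j))

/-- The monoid of positive braids, as a presented monoid. -/
abbrev BraidMonoid (m : ℕ) := PresentedMonoid (BraidStep m)

namespace BraidMonoid

variable {m : ℕ}

/-- The generators of the monoid of positive braids. -/
def s (i : Fin m) : BraidMonoid m := PresentedMonoid.of _ i

theorem mk_of_mul (i : Fin m) (a : FreeMonoid (Fin m)) :
    PresentedMonoid.mk (BraidStep m) (FreeMonoid.of i * a) = s i * PresentedMonoid.mk _ a := rfl

theorem far_comm {i j : Fin m} (h : Far i j) : s i * s j = s j * s i :=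
  PresentedMonoid.mk_eq_mk_of_rel (.comm i j h)

theorem near_braid {i j : Fin m} (h : Near i j) : s i * (s j * s i) = s j * (s i * s j) :=
  PresentedMonoid.mk_eq_mk_of_rel (.braid i j h)

theorem far_assoc {i j : Fin m} (h : Far i j) (x : BraidMonoid m) :
    s i * (s j * x) = s j * (s i * x) := by
  rw [← mul_assoc, far_comm h, mul_assoc]

theorem near_assoc {i j : Fin m} (h : Near i j) (x : BraidMonoid m) :
    s i * (s j * (s i * x)) = s j * (s i * (s j * x)) := by
  have := congrArg (· * x) (near_braid h)
  simpa only [mul_assoc] using this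

/-- The word length of a positive braid, as a homomorphism. -/
def lenHom (m : ℕ) : BraidMonoid m →* Multiplicative ℕ :=
  PresentedMonoid.lift (fun _ => Multiplicative.ofAdd 1) (by
    rintro a b (⟨i, j, h⟩ | ⟨i, j, h⟩) <;> simp)

/-- The word length of a positive braid. -/
def len (x : BraidMonoid m) : ℕ := (lenHom m x).toAdd

@[simp] theorem len_one : len (1 : BraidMonoid m) = 0 := by simp [len]

@[simp] theorem len_mul (x y : BraidMonoid m) : len (x * y) = len x + len y := by simp [len]

@[simp] theorem len_s (i : Fin m) : len (s i) = 1 := rfl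

/-- The pairs of tails `x`, `y` for which `s i * x` and `s j * y` are equal for the evident
reason that both are multiples of the least common multiple of `s i` and `s j`. -/
def Meet (i : Fin m) (x : BraidMonoid m) (j : Fin m) (y : BraidMonoid m) : Prop :=
  (i = j ∧ x = y) ∨ (Far i j ∧ ∃ z, x = s j * z ∧ y = s i * z) ∨
    (Near i j ∧ ∃ z, x = s j * (s i * z) ∧ y = s i * (s j * z))

theorem Meet.symm {i j : Fin m} {x y : BraidMonoid m} (h : Meet i x j y) : Meet j y i x := by
  rcases h with ⟨rfl, rfl⟩ | ⟨h, z, h1, h2⟩ | ⟨h, z, h1, h2⟩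
  · exact Or.inl ⟨rfl, rfl⟩
  · exact Or.inr (Or.inl ⟨h.symm, z, h2, h1⟩)
  · exact Or.inr (Or.inr ⟨h.symm, z, h2, h1⟩)

theorem Meet.mul_right {i j : Fin m} {x y : BraidMonoid m} (h : Meet i x j y)
    (c : BraidMonoid m) : Meet i (x * c) j (y * c) := by
  rcases h with ⟨rfl, rfl⟩ | ⟨h, z, rfl, rfl⟩ | ⟨h, z, rfl, rfl⟩
  · exact Or.inl ⟨rfl, rfl⟩
  · exact Or.inr (Or.inl ⟨h, z * c, by simp only [mul_assoc], by simp only [mul_assoc]⟩)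
  · exact Or.inr (Or.inr ⟨h, z * c, by simp only [mul_assoc], by simp only [mul_assoc]⟩)

theorem Meet.cancel {i : Fin m} {x y : BraidMonoid m} (h : Meet i x i y) : x = y := by
  rcases h with ⟨-, h⟩ | ⟨h, -⟩ | ⟨h, -⟩
  · exact h
  · unfold Far at h; omega
  · unfold Near at h; omega

theorem Meet.far {i j : Fin m} {x y : BraidMonoid m} (h : Meet i x j y) (hij : Far i j) :
    ∃ z, x = s j * z ∧ y = s i * z := by
  rcases h with ⟨rfl, -⟩ | ⟨-, h⟩ | ⟨h, -⟩
  · unfold Far at hij; omega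
  · exact h
  · unfold Far at hij; unfold Near at h; omega

theorem Meet.near {i j : Fin m} {x y : BraidMonoid m} (h : Meet i x j y) (hij : Near i j) :
    ∃ z, x = s j * (s i * z) ∧ y = s i * (s j * z) := by
  rcases h with ⟨rfl, -⟩ | ⟨h, -⟩ | ⟨-, h⟩
  · unfold Near at hij; omega
  · unfold Near at hij; unfold Far at h; omega
  · exact h

theorem Meet.trans_far_near {L : ℕ}
    (ih : ∀ (i j : Fin m) (x y : BraidMonoid m), len x < L → s i * x = s j * y → Meet i x j y)
    {i j k : Fin m} {x y w : BraidMonoid m} (hw : len w ≤ L)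
    (hik : Far i k) (hkj : Near k j) (h1 : Meet i x k w) (h2 : Meet k w j y) :
    Meet i x j y := by
  obtain ⟨z, rfl, rfl⟩ := h1.far hik
  obtain ⟨z', hz, rfl⟩ := h2.near hkj
  have l1 := congrArg len hz
  simp only [len_mul, len_s] at hw l1
  have M := ih i j z _ (by omega) hz
  rcases eq_or_far_or_near (i : ℕ) j with hij | hij | hij
  · unfold Far at hik; unfold Near at hkj; omega
  · obtain ⟨t, rfl, ht⟩ := M.far hij
    obtain ⟨r, rfl, rfl⟩ := (ih k i z' t (by omega) ht).far hik.symm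
    refine Or.inr (Or.inl ⟨hij, s k * (s j * r), near_assoc hkj r, ?_⟩)
    rw [far_assoc hij.symm, far_assoc hik.symm]
  · obtain ⟨t, rfl, ht⟩ := M.near hij
    obtain ⟨r, rfl, hr⟩ := (ih k i z' _ (by omega) ht).far hik.symm
    have l2 := congrArg len ht
    simp only [len_mul, len_s] at hw l2
    obtain ⟨p, rfl, rfl⟩ := (ih j k t r (by omega) hr).near hkj.symm
    refine Or.inr (Or.inr ⟨hij, s k * (s j * (s i * p)), ?_, ?_⟩)
    · rw [far_assoc hik, near_assoc hkj, near_assoc hij.symm, far_assoc hik.symm]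
    · rw [near_assoc hij.symm, far_assoc hik.symm, far_assoc hik p, near_assoc hkj]

theorem Meet.trans {L : ℕ}
    (ih : ∀ (i j : Fin m) (x y : BraidMonoid m), len x < L → s i * x = s j * y → Meet i x j y)
    {i j k : Fin m} {x y w : BraidMonoid m} (hw : len w ≤ L)
    (h1 : Meet i x k w) (h2 : Meet k w j y) : Meet i x j y := by
  rcases eq_or_far_or_near (i : ℕ) k with hik | hik | hik
  · obtain rfl := Fin.ext hik
    obtain rfl := h1.cancel
    exact h2
  · rcases eq_or_far_or_near (k : ℕ) j with hkj | hkj | hkj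
    · obtain rfl := Fin.ext hkj
      obtain rfl := h2.cancel
      exact h1
    · obtain ⟨z, rfl, rfl⟩ := h1.far hik
      obtain ⟨z', hz, rfl⟩ := h2.far hkj
      simp only [len_mul, len_s] at hw
      rcases ih i j z z' (by omega) hz with ⟨rfl, rfl⟩ | ⟨hij, t, rfl, rfl⟩ | ⟨hij, t, rfl, rfl⟩
      · exact Or.inl ⟨rfl, rfl⟩
      · exact Or.inr (Or.inl ⟨hij, s k * t, far_assoc hkj t, far_assoc hik.symm t⟩)
      · exact Or.inr (Or.inr ⟨hij, s k * t, by rw [far_assoc hkj, far_assoc hik.symm],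
          by rw [far_assoc hik.symm, far_assoc hkj]⟩)
    · exact Meet.trans_far_near ih hw hik hkj h1 h2
  · rcases eq_or_far_or_near (k : ℕ) j with hkj | hkj | hkj
    · obtain rfl := Fin.ext hkj
      obtain rfl := h2.cancel
      exact h1
    · exact (Meet.trans_far_near ih hw hkj.symm hik.symm h2.symm h1.symm).symm
    · obtain ⟨t, rfl, rfl⟩ := h1.near hik
      obtain ⟨u, hu, rfl⟩ := h2.near hkj
      have l1 := congrArg len hu
      simp only [len_mul, len_s] at hw l1
      have M := ih i j _ _ (by simp only [len_mul, len_s]; omega) hu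
      rcases eq_or_far_or_near (i : ℕ) j with hij | hij | hij
      · obtain rfl := Fin.ext hij
        obtain rfl := (ih k k t u (by omega) M.cancel).cancel
        exact Or.inl ⟨rfl, rfl⟩
      · obtain ⟨a, ha, hb⟩ := M.far hij
        obtain ⟨p, rfl, rfl⟩ := (ih k j t a (by omega) ha).near hkj
        obtain ⟨q, rfl, hq⟩ := (ih k i u _ (by omega) hb).near hik.symm
        have l2 := congrArg len ha
        simp only [len_mul, len_s] at hw l1 l2
        have hq' := (ih k k _ _ (by simp only [len_mul, len_s]; omega) hq).cancel
        obtain ⟨r, rfl, rfl⟩ := (ih j i p q (by omega) hq').far hij.symm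
        refine Or.inr (Or.inl ⟨hij, s k * (s i * (s j * (s k * r))), ?_, ?_⟩)
        · rw [far_assoc hij, near_assoc hik, near_assoc hkj, far_assoc hij]
        · rw [far_assoc hij.symm, near_assoc hkj.symm, near_assoc hik.symm]
      · unfold Near at hik hkj hij; omega

/-- Garside's lemma: two generators dividing an element have their least common multiple
dividing it. -/
theorem meet_of_mul_eq {i j : Fin m} {x y : BraidMonoid m} (h : s i * x = s j * y) :
    Meet i x j y := by
  suffices H : ∀ (L : ℕ) (i j : Fin m) (x y : BraidMonoid m), len x < L → s i * x = s j * y →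
      Meet i x j y from H _ i j x y (Nat.lt_succ_self _) h
  intro L
  induction L with
  | zero => intro _ _ _ _ h; omega
  | succ L ih =>
    intro i j x y hx hxy
    have key : ∀ u v : FreeMonoid (Fin m), ConGen.Rel (BraidStep m) u v →
        PresentedMonoid.mk (BraidStep m) u = PresentedMonoid.mk _ v ∧
        ((u = 1 ∧ v = 1) ∨ ∃ i a j b, u = FreeMonoid.of i * a ∧ v = FreeMonoid.of j * b ∧
          (len (PresentedMonoid.mk (BraidStep m) a) ≤ L →
            Meet i (PresentedMonoid.mk _ a) j (PresentedMonoid.mk _ b))) := by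
      intro u v huv
      induction huv with
      | of u v h =>
        refine ⟨PresentedMonoid.mk_eq_mk_of_rel h, Or.inr ?_⟩
        rcases h with ⟨i, j, h⟩ | ⟨i, j, h⟩
        · exact ⟨_, _, _, _, rfl, rfl, fun _ => Or.inr (Or.inl ⟨h, 1, rfl, rfl⟩)⟩
        · exact ⟨_, _, _, _, rfl, rfl, fun _ => Or.inr (Or.inr ⟨h, 1, rfl, rfl⟩)⟩
      | refl u =>
        refine ⟨rfl, ?_⟩
        cases u using FreeMonoid.casesOn with
        | one => exact Or.inl ⟨rfl, rfl⟩
        | of_mul i a => exact Or.inr ⟨_, _, _, _, rfl, rfl, fun _ => Or.inl ⟨rfl, rfl⟩⟩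
      | symm _ ih' =>
        obtain ⟨h1, ⟨rfl, rfl⟩ | ⟨i, a, j, b, rfl, rfl, h2⟩⟩ := ih'
        · exact ⟨rfl, Or.inl ⟨rfl, rfl⟩⟩
        · refine ⟨h1.symm, Or.inr ⟨_, _, _, _, rfl, rfl, fun hl => (h2 ?_).symm⟩⟩
          have := congrArg len h1
          simp only [mk_of_mul, len_mul, len_s] at this
          omega
      | trans _ _ ih1 ih2 =>
        obtain ⟨h1, ⟨rfl, rfl⟩ | ⟨i, a, k, c, rfl, rfl, h2⟩⟩ := ih1
        · exact ih2
        · obtain ⟨h3, ⟨h4, rfl⟩ | ⟨k', c', j, b, h4, rfl, h5⟩⟩ := ih2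
          · exact absurd h4 (by simp)
          · obtain ⟨rfl, rfl⟩ : k = k' ∧ c = c' := List.cons.inj h4
            refine ⟨h1.trans h3, Or.inr ⟨_, _, _, _, rfl, rfl, fun hl => ?_⟩⟩
            have := congrArg len h1
            simp only [mk_of_mul, len_mul, len_s] at this
            exact Meet.trans ih (by omega) (h2 hl) (h5 (by omega))
      | mul _ _ ih1 ih2 =>
        obtain ⟨h1, ⟨rfl, rfl⟩ | ⟨i, a, j, b, rfl, rfl, h2⟩⟩ := ih1
        · simpa only [one_mul] using ih2
        · obtain ⟨h3, -⟩ := ih2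
          refine ⟨by rw [map_mul _ (_ * a), map_mul _ (_ * b), h1, h3],
            Or.inr ⟨i, a * _, j, b * _, mul_assoc _ _ _,
              mul_assoc _ _ _, fun hl => ?_⟩⟩
          rw [map_mul, len_mul] at hl
          rw [map_mul, map_mul, h3]
          exact (h2 (by omega)).mul_right _
    obtain ⟨a, rfl⟩ := PresentedMonoid.surjective_mk x
    obtain ⟨b, rfl⟩ := PresentedMonoid.surjective_mk y
    have hr : conGen (BraidStep m) (FreeMonoid.of i * a) (FreeMonoid.of j * b) :=
      PresentedMonoid.mk_eq_mk_iff.1 hxy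
    obtain ⟨-, ⟨h, -⟩ | ⟨i', a', j', b', h1, h2, h3⟩⟩ := key _ _ hr
    · exact absurd h (by simp)
    · obtain ⟨rfl, rfl⟩ : i = i' ∧ a = a' := List.cons.inj h1
      obtain ⟨rfl, rfl⟩ : j = j' ∧ b = b' := List.cons.inj h2
      exact h3 (by omega)

theorem induction_left {P : BraidMonoid m → Prop} (one : P 1)
    (mul : ∀ i x, P x → P (s i * x)) (x : BraidMonoid m) : P x := by
  obtain ⟨a, rfl⟩ := PresentedMonoid.surjective_mk x
  induction a using FreeMonoid.inductionOn' with
  | one => exact one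
  | of_mul i a ih => exact mul i _ ih

theorem mul_left_cancel' {a x y : BraidMonoid m} (h : a * x = a * y) : x = y := by
  induction a using induction_left with
  | one => simpa using h
  | mul i a ih =>
    rw [mul_assoc, mul_assoc] at h
    exact ih (meet_of_mul_eq h).cancel

/-- Reversal of positive braids, as a homomorphism to the opposite monoid. -/
def revHom (m : ℕ) : BraidMonoid m →* (BraidMonoid m)ᵐᵒᵖ :=
  PresentedMonoid.lift (fun i => MulOpposite.op (s i)) (by
    rintro a b (⟨i, j, h⟩ | ⟨i, j, h⟩)
    · simp only [map_mul, FreeMonoid.lift_eval_of, ← MulOpposite.op_mul, far_comm h]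
    · simp only [map_mul, FreeMonoid.lift_eval_of, ← MulOpposite.op_mul, mul_assoc, near_braid h])

/-- Reversal of positive braids. -/
def rev (x : BraidMonoid m) : BraidMonoid m := (revHom m x).unop

theorem rev_mul (x y : BraidMonoid m) : rev (x * y) = rev y * rev x := by simp [rev]

theorem rev_s (i : Fin m) : rev (s i) = s i := rfl

theorem rev_rev (x : BraidMonoid m) : rev (rev x) = x := by
  induction x using induction_left with
  | one => simp [rev]
  | mul i x ih => rw [rev_mul, rev_mul, rev_s, rev_s, ih]

theorem rev_eq_iff {x y : BraidMonoid m} : rev x = y ↔ x = rev y :=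
  ⟨fun h => by rw [← h, rev_rev], fun h => by rw [h, rev_rev]⟩

theorem mul_right_cancel' {a x y : BraidMonoid m} (h : x * a = y * a) : x = y := by
  have := congrArg rev h
  rw [rev_mul, rev_mul] at this
  rw [← rev_rev x, mul_left_cancel' this, rev_rev]

theorem meet_of_mul_eq_right {i j : Fin m} {x y : BraidMonoid m} (h : x * s i = y * s j) :
    Meet i (rev x) j (rev y) := by
  have := congrArg rev h
  rw [rev_mul, rev_mul] at this
  exact meet_of_mul_eq this

theorem far_of_mul_eq_right {i j : Fin m} {x y : BraidMonoid m} (hij : Far i j)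
    (h : x * s i = y * s j) : ∃ z, x = z * s j ∧ y = z * s i := by
  obtain ⟨z, h1, h2⟩ := (meet_of_mul_eq_right h).far hij
  rw [rev_eq_iff, rev_mul, rev_s] at h1 h2
  exact ⟨rev z, h1, h2⟩

theorem near_of_mul_eq_right {i j : Fin m} {x y : BraidMonoid m} (hij : Near i j)
    (h : x * s i = y * s j) : ∃ z, x = z * s i * s j ∧ y = z * s j * s i := by
  obtain ⟨z, h1, h2⟩ := (meet_of_mul_eq_right h).near hij
  rw [rev_eq_iff, rev_mul, rev_mul, rev_s, rev_s] at h1 h2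
  exact ⟨rev z, h1, h2⟩

theorem len_mk (a : FreeMonoid (Fin m)) : len (PresentedMonoid.mk (BraidStep m) a) = a.length := by
  induction a using FreeMonoid.inductionOn' with
  | one => simp
  | of_mul i a ih => rw [mk_of_mul, len_mul, ih, FreeMonoid.length_mul]; simp

theorem finite_len_le (n : ℕ) : {x : BraidMonoid m | len x ≤ n}.Finite := by
  refine ((List.finite_length_le (Fin m) n).image
    (fun a => PresentedMonoid.mk (BraidStep m) (FreeMonoid.ofList a))).subset fun x hx => ?_
  obtain ⟨a, rfl⟩ := PresentedMonoid.surjective_mk x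
  exact ⟨a.toList, (len_mk a).symm.trans_le hx, rfl⟩

/-- The generators indexed by natural numbers, trivial when out of range. -/
def t (m i : ℕ) : BraidMonoid m := if h : i < m then s ⟨i, h⟩ else 1

theorem t_comm {i j : ℕ} (h : Far i j) : t m i * t m j = t m j * t m i := by
  unfold t
  split_ifs <;> simp [far_comm (i := (⟨i, _⟩ : Fin m)) (j := ⟨j, _⟩) h]

theorem t_braid {i : ℕ} (h : i + 1 < m) :
    t m i * t m (i + 1) * t m i = t m (i + 1) * t m i * t m (i + 1) := by
  have hi : i < m := by omega
  simp only [t, h, hi, dif_pos, mul_assoc]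
  exact near_braid (Or.inl rfl)

/-- The product of the first `k` generators. -/
def del (m : ℕ) : ℕ → BraidMonoid m
  | 0 => 1
  | k + 1 => del m k * t m k

/-- The product of the `k` generators following the first one. -/
def eps (m : ℕ) : ℕ → BraidMonoid m
  | 0 => 1
  | k + 1 => eps m k * t m (k + 1)

theorem t_zero_mul_eps (k : ℕ) : t m 0 * eps m k = del m (k + 1) := by
  induction k with
  | zero => simp [eps, del]
  | succ k ih => rw [eps, ← mul_assoc, ih, ← del]

theorem del_mul_t_of_lt {k i : ℕ} (h : k + 1 ≤ i) : del m k * t m i = t m i * del m k := by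
  induction k with
  | zero => simp [del]
  | succ k ih =>
    rw [del, mul_assoc, t_comm (i := k) (Or.inl (by omega)), ← mul_assoc, ih (by omega),
      mul_assoc]

theorem del_mul_t {k i : ℕ} (hi : i + 2 ≤ k) (hk : k ≤ m) :
    del m k * t m i = t m (i + 1) * del m k := by
  induction k, hi using Nat.le_induction with
  | base =>
    have := t_braid (show i + 1 < m by omega)
    rw [mul_assoc, mul_assoc] at this
    rw [del, del, mul_assoc, mul_assoc, this, ← mul_assoc, del_mul_t_of_lt le_rfl]
    simp only [mul_assoc]
  | succ k hik ih =>
    rw [del, mul_assoc, t_comm (Or.inr hik), ← mul_assoc, ih (by omega), mul_assoc]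

theorem del_mul_del {j : ℕ} (h : j + 1 ≤ m) : del m m * del m j = eps m j * del m m := by
  induction j with
  | zero => simp [del, eps]
  | succ j ih =>
    rw [del, ← mul_assoc, ih (by omega), mul_assoc, del_mul_t (by omega) le_rfl, eps, mul_assoc]

theorem del_sq_mul_t (k : ℕ) :
    del (k + 1) (k + 1) ^ 2 * t (k + 1) k = t (k + 1) 0 * del (k + 1) (k + 1) ^ 2 := by
  have h : del (k + 1) (k + 1) ^ 2 = del (k + 1) (k + 1) * del (k + 1) k * t (k + 1) k := by
    rw [sq, mul_assoc, ← del]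
  conv_rhs => rw [h, del_mul_del le_rfl, ← mul_assoc, ← mul_assoc, t_zero_mul_eps, ← sq]

theorem del_pow_mul_t {i : ℕ} (hi : i < m) :
    del m m ^ i * t m 0 = t m i * del m m ^ i := by
  induction i with
  | zero => simp
  | succ i ih =>
    rw [pow_succ', mul_assoc, ih (by omega), ← mul_assoc, del_mul_t (by omega) le_rfl, mul_assoc]

/-- A central positive braid divisible by all generators. -/
def cen (m : ℕ) : BraidMonoid m := del m m ^ (m + 1)

theorem cen_mul_t {i : ℕ} (hi : i < m) : cen m * t m i = t m i * cen m := by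
  obtain ⟨k, rfl⟩ : ∃ k, m = k + 1 := ⟨m - 1, by omega⟩
  have h0 : cen (k + 1) * t (k + 1) 0 = t (k + 1) 0 * cen (k + 1) := by
    have h : cen (k + 1) = del (k + 1) (k + 1) ^ 2 * del (k + 1) (k + 1) ^ k := by
      rw [cen, ← pow_add]; congr 1; omega
    rw [h, mul_assoc, del_pow_mul_t (Nat.lt_succ_self k), ← mul_assoc, del_sq_mul_t, mul_assoc]
  have hc : cen (k + 1) * del (k + 1) (k + 1) ^ i = del (k + 1) (k + 1) ^ i * cen (k + 1) :=
    Commute.pow_pow_self _ _ _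
  refine mul_right_cancel' (a := del (k + 1) (k + 1) ^ i) ?_
  rw [mul_assoc, ← del_pow_mul_t hi, ← mul_assoc, hc, mul_assoc, h0, ← mul_assoc,
    del_pow_mul_t hi, mul_assoc, ← hc, mul_assoc]

theorem cen_mul (x : BraidMonoid m) : cen m * x = x * cen m := by
  induction x using induction_left with
  | one => simp
  | mul i x ih =>
    have h : s i = t m i := by simp [t]
    rw [← mul_assoc, h, cen_mul_t i.2, mul_assoc, ih, mul_assoc]

theorem s_dvd_cen (i : Fin m) : ∃ d, s i * d = cen m := by
  have h : s i = t m i := by simp [t]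
  obtain ⟨k, hk⟩ : ∃ k, m = k + 1 := ⟨m - 1, by have := i.2; omega⟩
  have h1 : t m 0 * eps m k = del m m := by rw [t_zero_mul_eps, hk]
  refine ⟨del m m ^ (i : ℕ) * (eps m k * del m m ^ (m - i)), ?_⟩
  rw [← mul_assoc, h, ← del_pow_mul_t i.2, mul_assoc, ← mul_assoc (t m 0), h1, ← pow_succ',
    ← pow_add, cen]
  congr 1
  omega

theorem cen_pow_mul (k : ℕ) (x : BraidMonoid m) : cen m ^ k * x = x * cen m ^ k :=
  Commute.pow_left (cen_mul x) k

theorem exists_mul_eq_cen_pow (x : BraidMonoid m) : ∃ c k, x * c = cen m ^ k := by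
  induction x using induction_left with
  | one => exact ⟨1, 0, by simp⟩
  | mul i x ih =>
    obtain ⟨c, k, h⟩ := ih
    obtain ⟨d, hd⟩ := s_dvd_cen i
    refine ⟨c * d, k + 1, ?_⟩
    rw [← mul_assoc, mul_assoc (s i), h, ← cen_pow_mul, mul_assoc, hd, pow_succ]

/-- The edges of the divisibility graph on the left divisors of `N`. -/
def DivEdge (N : BraidMonoid m) (i : ℕ) (x y : {x : BraidMonoid m // ∃ c, x * c = N}) : Prop :=
  ∃ h : i < m, y.1 = x.1 * s ⟨i, h⟩

instance finite_divisors (N : BraidMonoid m) :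
    Finite {x : BraidMonoid m // ∃ c, x * c = N} := by
  refine Set.Finite.subset (finite_len_le (len N)) ?_
  rintro x ⟨c, rfl⟩
  simp

theorem braidGraph_divEdge (N : BraidMonoid m) : BraidGraph (DivEdge N) m where
  bound := fun ⟨h, _⟩ => h
  det := fun ⟨_, h⟩ ⟨_, h'⟩ => Subtype.ext (h.trans h'.symm)
  codet := fun ⟨_, h⟩ ⟨_, h'⟩ => Subtype.ext (mul_right_cancel' (h.symm.trans h'))
  far_up := by
    rintro i j ⟨x, _⟩ ⟨_, c, hc⟩ ⟨_, d, hd⟩ hf ⟨hi, rfl⟩ ⟨hj, rfl⟩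
    have hcd := hc.trans hd.symm
    rw [mul_assoc, mul_assoc] at hcd
    obtain ⟨z, rfl, rfl⟩ := (meet_of_mul_eq (mul_left_cancel' hcd)).far hf
    refine ⟨⟨x * s ⟨i, hi⟩ * s ⟨j, hj⟩, z, ?_⟩, ⟨hj, rfl⟩, ⟨hi, ?_⟩⟩
    · rw [← hd]; simp only [mul_assoc, far_assoc (i := ⟨i, hi⟩) (j := ⟨j, hj⟩) hf]
    · simp only [mul_assoc, far_comm (i := ⟨i, hi⟩) (j := ⟨j, hj⟩) hf]
  far_down := by
    rintro i j ⟨y, _⟩ ⟨z, _⟩ ⟨_, c, hc⟩ hf ⟨hi, rfl⟩ ⟨hj, h⟩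
    obtain ⟨x, rfl, rfl⟩ := far_of_mul_eq_right (i := ⟨i, hi⟩) (j := ⟨j, hj⟩) hf h
    exact ⟨⟨x, s ⟨j, hj⟩ * (s ⟨i, hi⟩ * c), by rw [← hc]; simp only [mul_assoc]⟩,
      ⟨hi, rfl⟩, ⟨hj, rfl⟩⟩
  far_swap := by
    rintro i j ⟨x, _⟩ ⟨_, _⟩ ⟨_, c, hc⟩ hf ⟨hi, rfl⟩ ⟨hj, rfl⟩
    have h : x * s ⟨i, hi⟩ * s ⟨j, hj⟩ = x * s ⟨j, hj⟩ * s ⟨i, hi⟩ := by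
      simp only [mul_assoc, far_comm (i := ⟨i, hi⟩) (j := ⟨j, hj⟩) hf]
    exact ⟨⟨x * s ⟨j, hj⟩, s ⟨i, hi⟩ * c, by rw [← hc, h]; simp only [mul_assoc]⟩,
      ⟨hj, rfl⟩, ⟨hi, h⟩⟩
  near_up := by
    rintro i j ⟨x, _⟩ ⟨_, c, hc⟩ ⟨_, d, hd⟩ hf ⟨hi, rfl⟩ ⟨hj, rfl⟩
    have hcd := hc.trans hd.symm
    rw [mul_assoc, mul_assoc] at hcd
    obtain ⟨z, rfl, rfl⟩ := (meet_of_mul_eq (mul_left_cancel' hcd)).near hf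
    have h := near_braid (i := ⟨i, hi⟩) (j := ⟨j, hj⟩) hf
    have h' := near_assoc (i := ⟨i, hi⟩) (j := ⟨j, hj⟩) hf
    refine ⟨⟨x * s ⟨i, hi⟩ * s ⟨j, hj⟩, s ⟨i, hi⟩ * z, ?_⟩,
      ⟨x * s ⟨j, hj⟩ * s ⟨i, hi⟩, s ⟨j, hj⟩ * z, ?_⟩,
      ⟨x * s ⟨i, hi⟩ * s ⟨j, hj⟩ * s ⟨i, hi⟩, z, ?_⟩,
      ⟨hj, rfl⟩, ⟨hi, rfl⟩, ⟨hi, rfl⟩, ⟨hj, ?_⟩⟩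
    · rw [← hd]; simp only [mul_assoc, h']
    · rw [← hd]; simp only [mul_assoc]
    · rw [← hd]; simp only [mul_assoc, h']
    · simp only [mul_assoc, h]
  near_down := by
    rintro i j ⟨y, _⟩ ⟨z, _⟩ ⟨_, c, hc⟩ hf ⟨hi, rfl⟩ ⟨hj, h⟩
    obtain ⟨x, rfl, rfl⟩ := near_of_mul_eq_right (i := ⟨i, hi⟩) (j := ⟨j, hj⟩) hf h
    refine ⟨⟨x, s ⟨i, hi⟩ * (s ⟨j, hj⟩ * (s ⟨i, hi⟩ * c)), ?_⟩,
      ⟨x * s ⟨i, hi⟩, s ⟨j, hj⟩ * (s ⟨i, hi⟩ * c), ?_⟩,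
      ⟨x * s ⟨j, hj⟩, s ⟨i, hi⟩ * (s ⟨j, hj⟩ * c), ?_⟩,
      ⟨hi, rfl⟩, ⟨hj, rfl⟩, ⟨hj, rfl⟩, ⟨hi, rfl⟩⟩ <;> rw [← hc] <;>
      simp only [mul_assoc, near_assoc (i := ⟨i, hi⟩) (j := ⟨j, hj⟩) hf]

theorem conn_of_mul {N : BraidMonoid m} (z x : BraidMonoid m) (hz : ∃ c, z * c = N)
    (hx : ∃ c, z * x * c = N) : Conn (DivEdge N) 0 ⟨z, hz⟩ ⟨z * x, hx⟩ := by
  induction x using induction_left generalizing z with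
  | one =>
    simp only [mul_one]
    exact .refl
  | mul i x ih =>
    obtain ⟨c, hc⟩ := id hx
    have h := ih (z * s i) ⟨x * c, by rw [← hc]; simp only [mul_assoc]⟩
      ⟨c, by rw [← hc]; simp only [mul_assoc]⟩
    simp only [mul_assoc] at h
    exact .head ⟨i, Nat.zero_le _, Or.inl ⟨i.2, rfl⟩⟩ h

end BraidMonoid

/-! ## Comparison with the braid group -/

variable {m : ℕ}

/-- The Artin generators, indexed from zero. -/
def σ (i : Fin m) : PresentedGroup (braidRels m) := PresentedGroup.of i

theorem σ_comm_of_lt {i j : Fin m} (h : (i : ℕ) + 2 ≤ j) : σ i * σ j = σ j * σ i := by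
  have : (PresentedGroup.mk (braidRels m) _) = 1 :=
    PresentedGroup.one_of_mem (Or.inl ⟨i, j, h, rfl⟩)
  simp only [map_mul, map_inv] at this
  rwa [mul_inv_eq_one, mul_inv_eq_iff_eq_mul] at this

theorem σ_braid_of_succ {i j : Fin m} (h : (j : ℕ) = i + 1) :
    σ i * σ j * σ i = σ j * σ i * σ j := by
  have : (PresentedGroup.mk (braidRels m) _) = 1 :=
    PresentedGroup.one_of_mem (Or.inr ⟨i, j, h, rfl⟩)
  simp only [map_mul, map_inv] at this
  rwa [mul_inv_eq_one] at this

theorem σ_comm {i j : Fin m} (h : Far i j) : σ i * σ j = σ j * σ i :=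
  h.elim σ_comm_of_lt fun h => (σ_comm_of_lt h).symm

theorem σ_braid {i j : Fin m} (h : Near i j) : σ i * (σ j * σ i) = σ j * (σ i * σ j) := by
  rw [← mul_assoc, ← mul_assoc]
  exact h.elim σ_braid_of_succ fun h => (σ_braid_of_succ h).symm

/-- The canonical homomorphism from positive braids to braids. -/
def toBraid (m : ℕ) : BraidMonoid m →* PresentedGroup (braidRels m) :=
  PresentedMonoid.lift σ (by
    rintro a b (⟨i, j, h⟩ | ⟨i, j, h⟩)
    · simpa only [map_mul, FreeMonoid.lift_eval_of] using σ_comm h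
    · simpa only [map_mul, FreeMonoid.lift_eval_of] using σ_braid h)

theorem toBraid_s (i : Fin m) : toBraid m (BraidMonoid.s i) = σ i := rfl

theorem exists_cen_pow_mul (β : PresentedGroup (braidRels m)) :
    ∃ k a, toBraid m (BraidMonoid.cen m ^ k) * β = toBraid m a := by
  have hβ : β ∈ Subgroup.closure (Set.range (σ (m := m))) := by
    have := PresentedGroup.closure_range_of (braidRels m)
    exact this ▸ Subgroup.mem_top β
  induction hβ using Subgroup.closure_induction_right with
  | one => exact ⟨0, 1, by simp⟩
  | mul_right x _ y hy ih =>
    obtain ⟨i, rfl⟩ := hy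
    obtain ⟨k, a, h⟩ := ih
    exact ⟨k, a * BraidMonoid.s i, by rw [← mul_assoc, h, map_mul, toBraid_s]⟩
  | mul_inv_cancel x _ y hy ih =>
    obtain ⟨i, rfl⟩ := hy
    obtain ⟨k, a, h⟩ := ih
    obtain ⟨d, hd⟩ := BraidMonoid.s_dvd_cen i
    have hd' : BraidMonoid.cen m = d * BraidMonoid.s i := by
      refine BraidMonoid.mul_left_cancel' (a := BraidMonoid.s i) ?_
      rw [← mul_assoc, hd, BraidMonoid.cen_mul]
    refine ⟨k + 1, a * d, ?_⟩
    rw [pow_succ', map_mul, mul_assoc, ← mul_assoc (toBraid m (_ ^ k)), h, ← mul_assoc, ← map_mul,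
      BraidMonoid.cen_mul, hd', map_mul, map_mul, toBraid_s, map_mul, mul_assoc, mul_assoc,
      mul_inv_cancel, mul_one]

/-- The braids having a word in generators of index at least `k`, where the generator of index `k`
itself only occurs with positive exponents. -/
def nonneg (m k : ℕ) : Submonoid (PresentedGroup (braidRels m)) :=
  Submonoid.closure {x | ∃ i : Fin m, (k ≤ i ∧ x = σ i) ∨ (k + 1 ≤ i ∧ x = (σ i)⁻¹)}

/-- The braids having a word as in `nonneg` in which the generator of index `k` occurs. -/
def Pos (k : Fin m) (x : PresentedGroup (braidRels m)) : Prop :=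
  ∃ a ∈ nonneg m k, ∃ b ∈ nonneg m k, x = a * σ k * b

theorem nonneg_of_upPath {N : BraidMonoid m} {k : ℕ} {x y : {x : BraidMonoid m // ∃ c, x * c = N}}
    (h : UpPath (BraidMonoid.DivEdge N) k x y) :
    (toBraid m x)⁻¹ * toBraid m y ∈ nonneg m k := by
  induction h with
  | refl => simp [one_mem]
  | @tail b c _ hbc ih =>
    suffices H : (toBraid m b)⁻¹ * toBraid m c ∈ nonneg m k by
      simpa [mul_assoc] using mul_mem ih H
    rcases hbc with ⟨hk, h⟩ | ⟨i, hi, ⟨hm, h⟩ | ⟨hm, h⟩⟩ <;>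
      simp only [h, map_mul, toBraid_s, mul_inv_rev, inv_mul_cancel_left, inv_mul_cancel_right] <;>
      refine Submonoid.subset_closure ?_
    · exact ⟨⟨k, hk⟩, Or.inl ⟨le_rfl, rfl⟩⟩
    · exact ⟨⟨i, hm⟩, Or.inl ⟨by simp only; omega, rfl⟩⟩
    · exact ⟨⟨i, hm⟩, Or.inr ⟨hi, by simp⟩⟩

theorem pos_of_strict {N : BraidMonoid m} {k : ℕ} {x y : {x : BraidMonoid m // ∃ c, x * c = N}}
    (h : Strict (BraidMonoid.DivEdge N) k x y) :
    ∃ hk : k < m, Pos ⟨k, hk⟩ ((toBraid m x)⁻¹ * toBraid m y) := by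
  obtain ⟨a, b, h1, ⟨hk, h2⟩, h3⟩ := h
  refine ⟨hk, _, nonneg_of_upPath h1, _, nonneg_of_upPath h3, ?_⟩
  rw [h2, map_mul, toBraid_s]
  group

/-- Every nontrivial braid or its inverse has a word in which the generator of lowest index
only occurs positively, provided such words never represent the trivial braid. -/
theorem eq_one_or_pos (hacyc : ∀ k : Fin m, ¬ Pos k 1) (β : PresentedGroup (braidRels m)) :
    β = 1 ∨ ∃ k, Pos k β ∨ Pos k β⁻¹ := by
  obtain ⟨k, a, h⟩ := exists_cen_pow_mul β
  obtain ⟨c, l, hc⟩ := BraidMonoid.exists_mul_eq_cen_pow a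
  set N : BraidMonoid m := BraidMonoid.cen m ^ k * BraidMonoid.cen m ^ l with hN
  have hx : ∃ c, BraidMonoid.cen m ^ k * c = N := ⟨_, rfl⟩
  have hy : ∃ c, a * c = N := ⟨c * BraidMonoid.cen m ^ k, by
    rw [← mul_assoc, hc, hN, BraidMonoid.cen_pow_mul]⟩
  have h0 : ∃ c, (1 : BraidMonoid m) * c = N := ⟨N, one_mul N⟩
  have c1 := BraidMonoid.conn_of_mul (N := N) 1 (BraidMonoid.cen m ^ k) h0 (by simpa using hx)
  have c2 := BraidMonoid.conn_of_mul (N := N) 1 a h0 (by simpa using hy)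
  simp only [one_mul] at c1 c2
  have hirr : ∀ k x, ¬ Strict (BraidMonoid.DivEdge N) k x x := by
    intro k x hs
    obtain ⟨hk, hp⟩ := pos_of_strict hs
    rw [inv_mul_cancel] at hp
    exact hacyc _ hp
  have hβ : β = (toBraid m (BraidMonoid.cen m ^ k))⁻¹ * toBraid m a := by
    rw [← h, inv_mul_cancel_left]
  rcases (BraidMonoid.braidGraph_divEdge N).eq_or_strict hirr m 0 (by omega) (c1.symm.trans c2)
    with h | ⟨i, h | h⟩
  · left
    rw [hβ, Subtype.mk.inj h, inv_mul_cancel]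
  · obtain ⟨hi, hp⟩ := pos_of_strict h
    exact Or.inr ⟨_, Or.inl (hβ ▸ hp)⟩
  · obtain ⟨hi, hp⟩ := pos_of_strict h
    refine Or.inr ⟨⟨i, hi⟩, Or.inr ?_⟩
    rwa [hβ, mul_inv_rev, inv_inv]

/-! ## A ping-pong action of the free group on the line -/

theorem unit_le_iff (g : CircleDeg1Liftˣ) {x y : ℝ} : g x ≤ g y ↔ x ≤ y :=
  (CircleDeg1Lift.toOrderIso g).le_iff_le

theorem unit_map_sub_one (g : CircleDeg1Liftˣ) (x : ℝ) : g (x - 1) = g x - 1 := by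
  simpa using CircleDeg1Lift.map_sub_int g x 1

/-- Ping-pong data: each `y j` expands the interval `[a j, b j]` around its fixed point `c j` so
much that it covers a full period, and the intervals are disjoint and in increasing order. -/
structure PingPong (y : ℕ → CircleDeg1Liftˣ) (a c b : ℕ → ℝ) : Prop where
  a_pos : ∀ j, 0 < a j
  a_le : ∀ j, a j ≤ c j
  le_b : ∀ j, c j ≤ b j
  b_lt : ∀ j, b j < 1
  b_le_a : ∀ {i j}, i < j → b i ≤ a j
  fix : ∀ j, y j (c j) = c j
  expand : ∀ j, a j + 1 ≤ y j (b j)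

/-- The position of a point relative to the ping-pong intervals, as predicted by a word. -/
def InReg (a c b : ℕ → ℝ) : List (ℕ × Bool) → ℤ → ℝ → Prop
  | [], k, x => x = k
  | (j, true) :: _, k, x => a j + k ≤ x ∧ x ≤ c j + k
  | (j, false) :: _, k, x => c j + k ≤ x ∧ x ≤ b j + k

/-- The change of the integer part when a letter is put in front of a word. -/
def shift (j : ℕ) : Bool → List (ℕ × Bool) → ℤ
  | true, [] => 0
  | true, (i, _) :: _ => if i ≤ j then 0 else 1
  | false, [] => -1
  | false, (i, _) :: _ => if i < j then -1 else 0

/-- The integer part of the image of the base point under a reduced word. -/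
def addr : List (ℕ × Bool) → ℤ
  | [] => 0
  | (j, ε) :: l => addr l + shift j ε l

/-- The image of the base point under an element of the free group. -/
def pt (y : ℕ → CircleDeg1Liftˣ) (w : FreeGroup ℕ) : ℝ := (FreeGroup.lift y w) 0

theorem pt_mul (y : ℕ → CircleDeg1Liftˣ) (v w : FreeGroup ℕ) :
    pt y (v * w) = (FreeGroup.lift y v) (pt y w) := by
  simp [pt]

theorem mk_cons_true (j : ℕ) (l : List (ℕ × Bool)) :
    FreeGroup.mk ((j, true) :: l) = FreeGroup.of j * FreeGroup.mk l := by
  rw [FreeGroup.of, FreeGroup.mul_mk]; rfl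

theorem mk_cons_false (j : ℕ) (l : List (ℕ × Bool)) :
    FreeGroup.mk ((j, false) :: l) = (FreeGroup.of j)⁻¹ * FreeGroup.mk l := by
  rw [FreeGroup.of, FreeGroup.inv_mk, FreeGroup.mul_mk]; rfl

namespace PingPong

variable {y : ℕ → CircleDeg1Liftˣ} {a c b : ℕ → ℝ}

theorem inReg_bounds (h : PingPong y a c b) {j : ℕ} {ε : Bool} {l : List (ℕ × Bool)} {k : ℤ}
    {x : ℝ} (hx : InReg a c b ((j, ε) :: l) k x) : a j + k ≤ x ∧ x ≤ b j + k := by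
  have := h.a_le j
  have := h.le_b j
  cases ε <;> simp only [InReg] at hx <;> constructor <;> linarith

theorem map_pos (h : PingPong y a c b) {j : ℕ} {k : ℤ} {x : ℝ} (h1 : b j - 1 + k ≤ x)
    (h2 : x ≤ c j + k) : a j + k ≤ y j x ∧ y j x ≤ c j + k := by
  have e1 : y j (b j - 1 + k) = y j (b j) - 1 + k := by
    rw [CircleDeg1Lift.map_add_int, unit_map_sub_one]
  have e2 : y j (c j + k) = c j + k := by simp [h.fix j]
  have := h.expand j
  have h1' := (unit_le_iff (y j)).2 h1
  have h2' := (unit_le_iff (y j)).2 h2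
  constructor <;> linarith

theorem map_neg (h : PingPong y a c b) {j : ℕ} {k : ℤ} {x : ℝ} (h1 : c j + k ≤ y j x)
    (h2 : y j x ≤ a j + 1 + k) : c j + k ≤ x ∧ x ≤ b j + k := by
  have e1 : y j (b j + k) = y j (b j) + k := by simp
  have e2 : y j (c j + k) = c j + k := by simp [h.fix j]
  have := h.expand j
  exact ⟨(unit_le_iff (y j)).1 (by linarith), (unit_le_iff (y j)).1 (by linarith)⟩

theorem inReg_addr (h : PingPong y a c b) {l : List (ℕ × Bool)} (hl : FreeGroup.IsReduced l) :
    InReg a c b l (addr l) (pt y (FreeGroup.mk l)) := by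
  induction l with
  | nil => simp [InReg, addr, pt, ← FreeGroup.one_eq_mk]
  | cons p l ih =>
    obtain ⟨j, ε⟩ := p
    have ih := ih hl.tail
    have := h.a_pos j
    have := h.a_le j
    have := h.le_b j
    have := h.b_lt j
    cases ε with
    | true =>
      rw [mk_cons_true, pt_mul, FreeGroup.lift_apply_of, InReg]
      apply h.map_pos
      all_goals
        rcases l with _ | ⟨⟨i, ε⟩, l⟩
        · simp only [addr, shift, InReg] at ih ⊢
          push_cast at ih ⊢
          linarith
        · have hb := h.inReg_bounds ih
          have := h.a_pos i
          have := h.b_lt i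
          simp only [addr, shift, Int.cast_add] at ih hb ⊢
          rcases lt_trichotomy i j with hij | rfl | hij
          · have := h.b_le_a hij
            rw [if_pos hij.le]
            push_cast
            linarith
          · obtain rfl : true = ε := (FreeGroup.isReduced_cons_cons.1 hl).1 rfl
            rw [if_pos le_rfl]
            simp only [InReg, Int.cast_add] at ih
            push_cast
            linarith
          · have := h.b_le_a hij
            rw [if_neg hij.not_ge]
            push_cast
            linarith
    | false =>
      rw [mk_cons_false, pt_mul, map_inv, FreeGroup.lift_apply_of, InReg]
      apply h.map_neg
      all_goals
        rw [CircleDeg1Lift.units_apply_inv_apply]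
        rcases l with _ | ⟨⟨i, ε⟩, l⟩
        · simp only [addr, shift, InReg] at ih ⊢
          push_cast at ih ⊢
          linarith
        · have hb := h.inReg_bounds ih
          have := h.a_pos i
          have := h.b_lt i
          simp only [addr, shift, Int.cast_add] at ih hb ⊢
          rcases lt_trichotomy i j with hij | rfl | hij
          · have := h.b_le_a hij
            rw [if_pos hij]
            push_cast
            linarith
          · obtain rfl : false = ε := (FreeGroup.isReduced_cons_cons.1 hl).1 rfl
            rw [if_neg (lt_irrefl _)]
            simp only [InReg, Int.cast_add] at ih
            push_cast
            linarith
          · have := h.b_le_a hij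
            rw [if_neg hij.le.not_gt]
            push_cast
            linarith

theorem pt_nonneg_iff (h : PingPong y a c b) (w : FreeGroup ℕ) :
    0 ≤ pt y w ↔ 0 ≤ addr w.toWord := by
  have hr := h.inReg_addr (FreeGroup.isReduced_toWord (x := w))
  rw [FreeGroup.mk_toWord] at hr
  generalize addr w.toWord = k at hr ⊢
  generalize w.toWord = l at hr
  rcases l with _ | ⟨⟨i, ε⟩, l⟩
  · simp only [InReg] at hr
    rw [hr]; exact_mod_cast Iff.rfl
  · have hb := h.inReg_bounds hr
    have := h.a_pos i
    have := h.b_lt i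
    constructor
    · intro h0
      have : (-1 : ℝ) < k := by linarith
      have : (-1 : ℤ) < k := by exact_mod_cast this
      omega
    · intro h0
      have : (0 : ℝ) ≤ k := by exact_mod_cast h0
      linarith

theorem pt_le_iff_nonneg (y : ℕ → CircleDeg1Liftˣ) (u v : FreeGroup ℕ) :
    pt y u ≤ pt y v ↔ 0 ≤ pt y (u⁻¹ * v) := by
  rw [← unit_le_iff (FreeGroup.lift y u⁻¹), ← pt_mul, ← pt_mul, inv_mul_cancel]
  simp [pt]

/-- The order in which the free group is mapped to the line does not depend on the ping-pong
data. -/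
theorem pt_le_iff {y' : ℕ → CircleDeg1Liftˣ} {a' c' b' : ℕ → ℝ} (h : PingPong y a c b)
    (h' : PingPong y' a' c' b') (u v : FreeGroup ℕ) : pt y u ≤ pt y v ↔ pt y' u ≤ pt y' v := by
  rw [pt_le_iff_nonneg, pt_le_iff_nonneg y', h.pt_nonneg_iff, h'.pt_nonneg_iff]

end PingPong

/-! ### Existence of ping-pong data -/

/-- A projective transformation of the unit interval fixing both ends. -/
noncomputable def moeb (K t : ℝ) : ℝ := K * t / (1 + (K - 1) * t)

theorem moeb_denom_pos {K t : ℝ} (hK : 0 < K) (h0 : 0 ≤ t) (h1 : t < 1) :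
    0 < 1 + (K - 1) * t := by nlinarith [mul_nonneg hK.le h0]

theorem moeb_mem {K t : ℝ} (hK : 0 < K) (h0 : 0 ≤ t) (h1 : t < 1) :
    0 ≤ moeb K t ∧ moeb K t < 1 := by
  have hd := moeb_denom_pos hK h0 h1
  refine ⟨div_nonneg (mul_nonneg hK.le h0) hd.le, ?_⟩
  rw [moeb, div_lt_one hd]
  linarith

theorem moeb_mono {K t u : ℝ} (hK : 0 < K) (h0 : 0 ≤ t) (htu : t ≤ u) (h1 : u < 1) :
    moeb K t ≤ moeb K u := by
  rw [moeb, moeb, div_le_div_iff₀ (moeb_denom_pos hK h0 (htu.trans_lt h1))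
    (moeb_denom_pos hK (h0.trans htu) h1)]
  nlinarith [mul_le_mul_of_nonneg_left htu hK.le]

theorem moeb_moeb_inv {K t : ℝ} (hK : 0 < K) (h0 : 0 ≤ t) (h1 : t < 1) :
    moeb K (moeb K⁻¹ t) = t := by
  have hd := (moeb_denom_pos (inv_pos.2 hK) h0 h1).ne'
  have e1 : K * (1 + (K⁻¹ - 1) * t) = K + (1 - K) * t := by field_simp
  have hd2 : K + (1 - K) * t ≠ 0 := e1 ▸ mul_ne_zero hK.ne' hd
  have e2 : moeb K⁻¹ t = t / (K + (1 - K) * t) := by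
    rw [moeb, ← e1, div_eq_div_iff hd (mul_ne_zero hK.ne' hd)]
    field_simp
  have e3 : 1 + (K - 1) * (t / (K + (1 - K) * t)) = K / (K + (1 - K) * t) := by
    rw [eq_div_iff hd2, add_mul, mul_assoc, div_mul_cancel₀ _ hd2]
    ring
  rw [e2, moeb, e3, ← mul_div_assoc, div_div_div_cancel_right₀ hd2, mul_div_cancel_left₀ _ hK.ne']

/-- The periodic extension of `moeb`, centred at `p`, as a lift of a circle map. -/
noncomputable def moebLift (K p : ℝ) (hK : 0 < K) : CircleDeg1Lift where
  toFun x := ⌊x - p⌋ + moeb K (Int.fract (x - p)) + p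
  monotone' x z h := by
    have h' : x - p ≤ z - p := by linarith
    have hx := moeb_mem hK (Int.fract_nonneg (x - p)) (Int.fract_lt_one _)
    have hz := moeb_mem hK (Int.fract_nonneg (z - p)) (Int.fract_lt_one _)
    rcases (Int.floor_mono h').lt_or_eq with hlt | heq
    · have : (⌊x - p⌋ : ℝ) + 1 ≤ ⌊z - p⌋ := by exact_mod_cast hlt
      simp only; linarith
    · have hf : Int.fract (x - p) ≤ Int.fract (z - p) := by
        rw [Int.fract, Int.fract, heq]; linarith
      have := moeb_mono hK (Int.fract_nonneg _) hf (Int.fract_lt_one _)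
      simp only [heq]; linarith
  map_add_one' x := by
    have : x + 1 - p = x - p + 1 := by ring
    simp only [this, Int.floor_add_one, Int.fract_add_one]
    push_cast
    ring

theorem moebLift_apply {K p : ℝ} (hK : 0 < K) {x : ℝ} (h0 : p ≤ x) (h1 : x < p + 1) :
    moebLift K p hK x = moeb K (x - p) + p := by
  have hf : ⌊x - p⌋ = 0 := Int.floor_eq_zero_iff.2 ⟨by linarith, by linarith⟩
  change (⌊x - p⌋ : ℝ) + moeb K (Int.fract (x - p)) + p = _
  rw [Int.fract, hf]
  simp

theorem moebLift_mul {K L p : ℝ} (hK : 0 < K) (hL : 0 < L) (h : L = K⁻¹) :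
    moebLift K p hK * moebLift L p hL = 1 := by
  subst h
  ext x
  have hm := moeb_mem hL (Int.fract_nonneg (x - p)) (Int.fract_lt_one _)
  have e : moebLift K⁻¹ p hL x = moeb K⁻¹ (Int.fract (x - p)) + p + (⌊x - p⌋ : ℤ) := by
    change (⌊x - p⌋ : ℝ) + _ + p = _
    ring
  rw [CircleDeg1Lift.mul_apply, e, CircleDeg1Lift.map_add_int,
    moebLift_apply hK (by linarith) (by linarith), add_sub_cancel_right,
    moeb_moeb_inv hK (Int.fract_nonneg _) (Int.fract_lt_one _), CircleDeg1Lift.coe_one, id,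
    Int.fract]
  ring

/-- The invertible version of `moebLift`. -/
noncomputable def moebUnit (K p : ℝ) (hK : 0 < K) : CircleDeg1Liftˣ where
  val := moebLift K p hK
  inv := moebLift K⁻¹ p (inv_pos.2 hK)
  val_inv := moebLift_mul _ _ rfl
  inv_val := moebLift_mul _ _ (inv_inv K).symm

theorem exists_expanding {a b : ℝ} (hab : a < b) (ha : 0 < a) (hb : b < 1) :
    ∃ g : CircleDeg1Liftˣ, g ((a + b) / 2) = (a + b) / 2 ∧ a + 1 ≤ g b := by
  have hδ : 0 < (b - a) / 2 := by linarith
  have hK : 0 < (((b - a) / 2) ^ 2)⁻¹ := by positivity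
  refine ⟨moebUnit _ ((a + b) / 2) hK, ?_, ?_⟩
  · refine (moebLift_apply hK le_rfl (by linarith)).trans ?_
    simp [moeb]
  · refine le_of_le_of_eq ?_ (moebLift_apply hK (by linarith) (by linarith)).symm
    have e : b - (a + b) / 2 = (b - a) / 2 := by ring
    rw [e]
    have e' : a + 1 = 1 - (b - a) / 2 + (a + b) / 2 := by ring
    rw [e']
    have hδ1 : (b - a) / 2 < 1 := by linarith
    generalize (b - a) / 2 = δ at *
    gcongr
    rw [moeb, le_div_iff₀ (moeb_denom_pos hK hδ.le hδ1)]
    have h1 : (δ ^ 2)⁻¹ * δ * δ = 1 := by field_simp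
    nlinarith

theorem exists_pingPong : ∃ y a c b, PingPong y a c b := by
  have hlt : ∀ j : ℕ, (1 - 1 / (j + 2) : ℝ) < 1 - 1 / (j + 3) := fun j => by
    have : (1 : ℝ) / (j + 3) < 1 / (j + 2) :=
      one_div_lt_one_div_of_lt (by positivity) (by linarith)
    linarith
  have hpos : ∀ j : ℕ, (0 : ℝ) < 1 - 1 / (j + 2) := fun j => by
    have h2 : (1 : ℝ) < j + 2 := by have : (0 : ℝ) ≤ j := j.cast_nonneg; linarith
    have : (1 : ℝ) / (j + 2) < 1 := (div_lt_one (by linarith)).2 h2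
    linarith
  have hone : ∀ j : ℕ, (1 - 1 / (j + 3) : ℝ) < 1 := fun j => by
    have : (0 : ℝ) < 1 / (j + 3) := by positivity
    linarith
  choose g hg using fun j => exists_expanding (hlt j) (hpos j) (hone j)
  refine ⟨g, _, _, _, hpos, fun j => ?_, fun j => ?_, hone, fun {i j} hij => ?_,
    fun j => (hg j).1, fun j => (hg j).2⟩
  · linarith [hlt j]
  · linarith [hlt j]
  · have : (i : ℝ) + 1 ≤ j := by exact_mod_cast hij
    have : (1 : ℝ) / (j + 2) ≤ 1 / (i + 3) :=
      one_div_le_one_div_of_le (by positivity) (by linarith)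
    linarith

/-! ## The Artin action on the free group -/

/-- The `i`-th Artin automorphism, as an endomorphism. -/
def artinHom (i : ℕ) : FreeGroup ℕ →* FreeGroup ℕ :=
  FreeGroup.lift fun j =>
    if j = i then .of i * .of (i + 1) * (.of i)⁻¹ else if j = i + 1 then .of i else .of j

/-- The inverse of the `i`-th Artin automorphism. -/
def artinInv (i : ℕ) : FreeGroup ℕ →* FreeGroup ℕ :=
  FreeGroup.lift fun j =>
    if j = i then .of (i + 1) else if j = i + 1 then (.of (i + 1))⁻¹ * .of i * .of (i + 1)
    else .of j

theorem artinHom_self (i : ℕ) :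
    artinHom i (.of i) = .of i * .of (i + 1) * (.of i)⁻¹ := by simp [artinHom]

theorem artinHom_succ (i : ℕ) : artinHom i (.of (i + 1)) = .of i := by simp [artinHom]

theorem artinHom_of_ne {i j : ℕ} (h : j ≠ i) (h' : j ≠ i + 1) : artinHom i (.of j) = .of j := by
  simp [artinHom, h, h']

theorem artinInv_self (i : ℕ) : artinInv i (.of i) = .of (i + 1) := by simp [artinInv]

theorem artinInv_succ (i : ℕ) :
    artinInv i (.of (i + 1)) = (.of (i + 1))⁻¹ * .of i * .of (i + 1) := by simp [artinInv]

theorem artinInv_of_ne {i j : ℕ} (h : j ≠ i) (h' : j ≠ i + 1) : artinInv i (.of j) = .of j := by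
  simp [artinInv, h, h']

/-- The `i`-th Artin automorphism of the free group. -/
def artin (i : ℕ) : MulAut (FreeGroup ℕ) :=
  (artinHom i).toMulEquiv (artinInv i)
    (FreeGroup.ext_hom _ _ fun j => by
      simp only [MonoidHom.comp_apply, MonoidHom.id_apply]
      by_cases h : j = i
      · subst h
        simp only [artinHom_self, map_mul, map_inv, artinInv_self, artinInv_succ]
        group
      by_cases h' : j = i + 1
      · subst h'
        rw [artinHom_succ, artinInv_self]
      rw [artinHom_of_ne h h', artinInv_of_ne h h'])
    (FreeGroup.ext_hom _ _ fun j => by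
      simp only [MonoidHom.comp_apply, MonoidHom.id_apply]
      by_cases h : j = i
      · subst h
        rw [artinInv_self, artinHom_succ]
      by_cases h' : j = i + 1
      · subst h'
        simp only [artinInv_succ, map_mul, map_inv, artinHom_self, artinHom_succ]
        group
      rw [artinInv_of_ne h h', artinHom_of_ne h h'])

theorem artin_apply (i : ℕ) (w : FreeGroup ℕ) : artin i w = artinHom i w := rfl

theorem mulAut_ext {f g : MulAut (FreeGroup ℕ)} (h : ∀ j, f (.of j) = g (.of j)) : f = g :=
  MulEquiv.toMonoidHom_injective (FreeGroup.ext_hom _ _ h)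

theorem artin_comm {i j : ℕ} (h : i + 2 ≤ j) : artin i * artin j = artin j * artin i := by
  refine mulAut_ext fun k => ?_
  simp only [MulAut.mul_apply, artin_apply]
  have n1 : i ≠ j := by omega
  have n2 : i ≠ j + 1 := by omega
  have n3 : i + 1 ≠ j := by omega
  have n4 : i + 1 ≠ j + 1 := by omega
  by_cases h1 : k = i
  · subst h1
    simp only [artinHom_of_ne n1 n2, artinHom_self, map_mul, map_inv, artinHom_of_ne n3 n4]
  by_cases h2 : k = i + 1
  · subst h2
    simp only [artinHom_of_ne n1 n2, artinHom_succ, artinHom_of_ne n3 n4]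
  by_cases h3 : k = j
  · subst h3
    simp only [artinHom_of_ne n1.symm n3.symm, artinHom_self, map_mul, map_inv,
      artinHom_of_ne n2.symm n4.symm]
  by_cases h4 : k = j + 1
  · subst h4
    simp only [artinHom_of_ne n1.symm n3.symm, artinHom_succ, artinHom_of_ne n2.symm n4.symm]
  rw [artinHom_of_ne h3 h4, artinHom_of_ne h1 h2, artinHom_of_ne h3 h4]

theorem artin_braid (i : ℕ) :
    artin i * artin (i + 1) * artin i = artin (i + 1) * artin i * artin (i + 1) := by
  refine mulAut_ext fun k => ?_
  simp only [MulAut.mul_apply, artin_apply]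
  have e1 : artinHom (i + 1) (.of i) = .of i := artinHom_of_ne (by omega) (by omega)
  have e2 : artinHom i (.of (i + 1 + 1)) = .of (i + 1 + 1) := artinHom_of_ne (by omega) (by omega)
  by_cases h1 : k = i
  · subst h1
    simp only [artinHom_self, artinHom_succ, map_mul, map_inv, e1, e2]
    group
  by_cases h2 : k = i + 1
  · subst h2
    simp only [artinHom_self, artinHom_succ, map_mul, map_inv, e1, e2]
  by_cases h3 : k = i + 1 + 1
  · subst h3
    simp only [artinHom_succ, e1, e2]
  rw [artinHom_of_ne h1 h2, artinHom_of_ne h2 h3, artinHom_of_ne h1 h2, artinHom_of_ne h2 h3]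

/-- The action of the braid group on the free group. -/
def artinRep (m : ℕ) : PresentedGroup (braidRels m) →* MulAut (FreeGroup ℕ) :=
  PresentedGroup.toGroup (f := fun i : Fin m => artin i) (by
    rintro r (⟨i, j, h, rfl⟩ | ⟨i, j, h, rfl⟩)
    · simp only [map_mul, map_inv, FreeGroup.lift_apply_of]
      rw [artin_comm h, mul_inv_cancel_right, mul_inv_cancel]
    · simp only [map_mul, map_inv, FreeGroup.lift_apply_of]
      rw [h, artin_braid, mul_inv_cancel])

theorem artinRep_σ {m : ℕ} (i : Fin m) : artinRep m (σ i) = artin i :=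
  PresentedGroup.toGroup.of _

namespace PingPong

variable {y : ℕ → CircleDeg1Liftˣ} {a c b : ℕ → ℝ}

theorem artin (h : PingPong y a c b) (i : ℕ) :
    ∃ a' c' b', PingPong (fun j => FreeGroup.lift y (artinHom i (.of j))) a' c' b' := by
  have hlt := h.b_le_a (Nat.lt_succ_self i)
  have ha := h.a_pos
  have hac := h.a_le
  have hcb := h.le_b
  have hb := h.b_lt
  have key1 : a i ≤ y i (a (i + 1)) - 1 := by
    have := (unit_le_iff (y i)).2 hlt
    linarith [h.expand i]
  have key2 : y i (b (i + 1)) - 1 ≤ c i := by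
    have : y i (b (i + 1)) ≤ y i (c i + 1) :=
      (unit_le_iff (y i)).2 (by linarith [ha i, hac i, hb (i + 1)])
    rw [CircleDeg1Lift.map_add_one, h.fix] at this
    linarith
  have key3 := (unit_le_iff (y i)).2 (hac (i + 1))
  have key4 := (unit_le_iff (y i)).2 (hcb (i + 1))
  refine ⟨fun j => if j = i then y i (a (i + 1)) - 1 else
      if j = i + 1 then y i (b (i + 1)) - 1 else a j,
    fun j => if j = i then y i (c (i + 1)) - 1 else if j = i + 1 then c i else c j,
    fun j => if j = i then y i (b (i + 1)) - 1 else b j,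
    fun j => ?_, fun j => ?_, fun j => ?_, fun j => ?_, fun {j k} hjk => ?_, fun j => ?_,
    fun j => ?_⟩
  · have := ha j; have := ha i
    split_ifs <;> linarith
  · have := hac j
    split_ifs <;> linarith
  · have := hcb j
    split_ifs with h1 h2
    · linarith
    · subst h2; linarith [hac (i + 1), hcb i]
    · linarith
  · have := hb j
    split_ifs <;> linarith [hcb i, hb i]
  · split_ifs with h1 h2 h3 h4 h5
    · omega
    · exact le_rfl
    · have := h.b_le_a (i := i) (j := k) (by omega); linarith [hcb i]
    · subst h4; linarith [h.b_le_a hjk]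
    · have := h.b_le_a (i := j) (j := i) (by omega); linarith
    · exact h.b_le_a hjk
  · by_cases h1 : j = i
    · subst h1
      simp [artinHom_self, unit_map_sub_one, h.fix]
    by_cases h2 : j = i + 1
    · subst h2
      simp [artinHom_succ, h.fix]
    simp [artinHom_of_ne h1 h2, h1, h2, h.fix]
  · by_cases h1 : j = i
    · subst h1
      simp only [artinHom_self, if_true, map_mul, map_inv, FreeGroup.lift_apply_of]
      have := (unit_le_iff (y j)).2 (h.expand (j + 1))
      rw [CircleDeg1Lift.map_add_one] at this
      simpa [unit_map_sub_one, le_sub_iff_add_le] using this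
    by_cases h2 : j = i + 1
    · subst h2
      simp [artinHom_succ]
    simpa [artinHom_of_ne h1 h2, h1, h2] using h.expand j

theorem pt_artin_le_iff (h : PingPong y a c b) (i : ℕ) (u v : FreeGroup ℕ) :
    pt y (BraidOrder.artin i u) ≤ pt y (BraidOrder.artin i v) ↔ pt y u ≤ pt y v := by
  obtain ⟨a', c', b', h'⟩ := h.artin i
  have e : FreeGroup.lift (fun j => FreeGroup.lift y (artinHom i (.of j))) =
      (FreeGroup.lift y).comp (artinHom i) := FreeGroup.ext_hom _ _ fun j => by simp
  have := h.pt_le_iff h' u v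
  simp only [pt, e, MonoidHom.comp_apply] at this
  exact this.symm

theorem pt_artinRep_le_iff (h : PingPong y a c b) {m : ℕ} (g : PresentedGroup (braidRels m))
    (u v : FreeGroup ℕ) :
    pt y (artinRep m g u) ≤ pt y (artinRep m g v) ↔ pt y u ≤ pt y v := by
  have hg : g ∈ Subgroup.closure (Set.range (σ (m := m))) := by
    have := PresentedGroup.closure_range_of (braidRels m)
    exact this ▸ Subgroup.mem_top g
  induction hg using Subgroup.closure_induction generalizing u v with
  | mem g hg =>
    obtain ⟨i, rfl⟩ := hg
    rw [artinRep_σ, h.pt_artin_le_iff]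
  | one => simp
  | mul g g' _ _ ih ih' => 
    rw [map_mul, MulAut.mul_apply, MulAut.mul_apply]
    exact (ih _ _).trans (ih' u v)
  | inv g _ ih =>
    refine (ih _ _).symm.trans ?_
    rw [← MulAut.mul_apply, ← MulAut.mul_apply, ← map_mul, mul_inv_cancel, map_one,
      MulAut.one_apply, MulAut.one_apply]

theorem pt_artinRep_lt_iff (h : PingPong y a c b) {m : ℕ} (g : PresentedGroup (braidRels m))
    (u v : FreeGroup ℕ) :
    pt y (artinRep m g u) < pt y (artinRep m g v) ↔ pt y u < pt y v := by
  rw [← not_le, ← not_le, h.pt_artinRep_le_iff]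

end PingPong

/-! ### Artin automorphisms move points to the left -/

namespace PingPong

variable {y : ℕ → CircleDeg1Liftˣ} {a c b : ℕ → ℝ}

theorem le_map_map_of_gap (h : PingPong y a c b) (i : ℕ) {k : ℤ} {x : ℝ}
    (h1 : b (i + 1) - 1 + k ≤ x) (h2 : x ≤ a i + k) : x + 1 ≤ y i (y (i + 1) x) := by
  have hQ := (unit_le_iff (y (i + 1))).2 h1
  rw [CircleDeg1Lift.map_add_int, unit_map_sub_one] at hQ
  have hlt := h.b_le_a (Nat.lt_succ_self i)
  have hP : y i (b i + k) ≤ y i (y (i + 1) x) :=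
    (unit_le_iff (y i)).2 (by linarith [h.expand (i + 1)])
  rw [CircleDeg1Lift.map_add_int] at hP
  linarith [h.expand i]

theorem map_map_le (h : PingPong y a c b) (i : ℕ) {k : ℤ} {z : ℝ}
    (h1 : y i (c (i + 1)) - 1 + k ≤ z) (h2 : y (i + 1) z ≤ c i + 1 + k) :
    y i (y (i + 1) z) ≤ z + 1 := by
  rcases le_total z (c (i + 1) + k) with hz | hz
  · have hQ := (unit_le_iff (y (i + 1))).2 hz
    rw [CircleDeg1Lift.map_add_int, h.fix] at hQ
    have hP := (unit_le_iff (y i)).2 hQ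
    rw [CircleDeg1Lift.map_add_int] at hP
    linarith
  · have hP := (unit_le_iff (y i)).2 h2
    rw [CircleDeg1Lift.map_add_int, CircleDeg1Lift.map_add_one, h.fix] at hP
    linarith [h.b_le_a (Nat.lt_succ_self i), h.a_le (i + 1), h.le_b i]

theorem map_map_le_of_mem (h : PingPong y a c b) (i : ℕ) {k : ℤ} {z : ℝ}
    (h1 : c i + k ≤ z) (h2 : z ≤ c (i + 1) + k) : y i (y (i + 1) z) ≤ z + 1 := by
  have hP : y i (c (i + 1)) ≤ y i (c i + 1) :=
    (unit_le_iff (y i)).2 (by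
      linarith [h.le_b (i + 1), h.b_lt (i + 1), h.a_pos i, h.a_le i])
  rw [CircleDeg1Lift.map_add_one, h.fix] at hP
  have hQ := (unit_le_iff (y (i + 1))).2 h2
  rw [CircleDeg1Lift.map_add_int, h.fix] at hQ
  exact h.map_map_le i (k := k) (by linarith)
    (by linarith [h.le_b (i + 1), h.b_lt (i + 1), h.a_pos i, h.a_le i])

theorem map_map_le_of_pos (h : PingPong y a c b) (i : ℕ) {l : List (ℕ × Bool)}
    (hl : FreeGroup.IsReduced ((i, true) :: l)) (hn : ∀ l', l ≠ (i + 1, true) :: l') :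
    y i (y (i + 1) (pt y (.mk ((i, true) :: l)))) ≤ pt y (.mk ((i, true) :: l)) + 1 := by
  have hx := h.inReg_addr hl
  have ht : InReg a c b l (addr l) (pt y (.mk l)) := h.inReg_addr hl.tail
  have hlt := h.b_le_a (Nat.lt_succ_self i)
  have haQ := h.a_le (i + 1)
  have hbQ := h.le_b (i + 1)
  have hbQ1 := h.b_lt (i + 1)
  have haP := h.a_pos i
  have haP' := h.a_le i
  have hbP := h.le_b i
  have hx2 := hx.2
  have hQ : y (i + 1) (pt y (.mk ((i, true) :: l))) ≤ c (i + 1) + addr ((i, true) :: l) := by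
    have := (unit_le_iff (y (i + 1))).2
      (show pt y (.mk ((i, true) :: l)) ≤ c (i + 1) + addr ((i, true) :: l) by linarith)
    rwa [CircleDeg1Lift.map_add_int, h.fix] at this
  refine h.map_map_le i (k := addr ((i, true) :: l)) ?_ (by linarith)
  rw [mk_cons_true, pt_mul, FreeGroup.lift_apply_of]
  have key : c (i + 1) - 1 + addr ((i, true) :: l) ≤ pt y (.mk l) := by
    rcases l with _ | ⟨⟨j, ε⟩, l⟩
    · simp only [InReg, addr, shift] at ht ⊢
      push_cast at ht ⊢
      linarith
    · have hb := h.inReg_bounds ht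
      have := h.a_pos j
      rcases le_or_gt j i with hj | hj
      · have e : addr ((i, true) :: (j, ε) :: l) = addr ((j, ε) :: l) := by
          conv_lhs => rw [addr, shift, if_pos hj, add_zero]
        rw [e]
        linarith
      · have e : addr ((i, true) :: (j, ε) :: l) = addr ((j, ε) :: l) + 1 := by
          conv_lhs => rw [addr, shift, if_neg hj.not_ge]
        rw [e]
        push_cast
        have hj1 : i + 1 ≤ j := hj
        rcases hj1.eq_or_lt with rfl | hj'
        · cases ε with
          | true => exact absurd rfl (hn l)
          | false => linarith [ht.1]
        · have := h.b_le_a hj'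
          linarith
  have := (unit_le_iff (y i)).2 key
  rwa [CircleDeg1Lift.map_add_int, unit_map_sub_one] at this

theorem map_map_le_of_neg (h : PingPong y a c b) (i : ℕ) {l : List (ℕ × Bool)}
    (hl : FreeGroup.IsReduced ((i + 1, false) :: l)) (hn : ∀ l', l ≠ (i, false) :: l') :
    y i (y (i + 1) (pt y (.mk ((i + 1, false) :: l)))) ≤
      pt y (.mk ((i + 1, false) :: l)) + 1 := by
  have hx := (h.inReg_addr hl).1
  have ht : InReg a c b l (addr l) (pt y (.mk l)) := h.inReg_addr hl.tail
  have hP : y i (c (i + 1)) ≤ y i (c i + 1) :=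
    (unit_le_iff (y i)).2 (by
      linarith [h.le_b (i + 1), h.b_lt (i + 1), h.a_pos i, h.a_le i])
  rw [CircleDeg1Lift.map_add_one, h.fix] at hP
  have hlt := h.b_le_a (Nat.lt_succ_self i)
  refine h.map_map_le i (k := addr ((i + 1, false) :: l))
    (by linarith [h.le_b i, h.a_le (i + 1)]) ?_
  rw [mk_cons_false, pt_mul, map_inv, FreeGroup.lift_apply_of,
    CircleDeg1Lift.units_apply_inv_apply]
  have haP := h.a_pos i
  have haP' := h.a_le i
  rcases l with _ | ⟨⟨j, ε⟩, l⟩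
  · simp only [InReg, addr, shift] at ht ⊢
    push_cast at ht ⊢
    linarith
  · have hb := h.inReg_bounds ht
    have := h.b_lt j
    rcases lt_or_ge j (i + 1) with hj | hj
    · have e : addr ((i + 1, false) :: (j, ε) :: l) = addr ((j, ε) :: l) + -1 := by
        conv_lhs => rw [addr, shift, if_pos hj]
      rw [e]
      push_cast
      rcases (Nat.lt_succ_iff.1 hj).eq_or_lt with rfl | hj'
      · cases ε with
        | true => linarith [ht.2]
        | false => exact absurd rfl (hn l)
      · have := h.b_le_a hj'
        linarith
    · have e : addr ((i + 1, false) :: (j, ε) :: l) = addr ((j, ε) :: l) := by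
        conv_lhs => rw [addr, shift, if_neg hj.not_gt, add_zero]
      rw [e]
      linarith

theorem pt_artin_artin_aux (h : PingPong y a c b) (i : ℕ) {T : FreeGroup ℕ →* CircleDeg1Liftˣ}
    (hT : ∀ j, j ≠ i → j ≠ i + 1 → T (.of j) = y j)
    (hTi : T (.of i) = y i * y (i + 1) * y i * (y i * y (i + 1))⁻¹)
    (hTi' : T (.of (i + 1)) = y i * y (i + 1) * y (i + 1) * (y i * y (i + 1))⁻¹)
    {l : List (ℕ × Bool)} (hl : FreeGroup.IsReduced l) :
    T (.mk l) 0 ≤ pt y (.mk l) ∧ T (.mk l) 0 + 1 ≤ y i (y (i + 1) (pt y (.mk l))) := by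
  have step : ∀ (D e : CircleDeg1Liftˣ) {x x' : ℝ},
      x' + 1 ≤ D x → (D * e * D⁻¹) x' + 1 ≤ D (e x) := by
    intro D e x x' hx
    rw [← CircleDeg1Lift.map_add_one, Units.val_mul, Units.val_mul, CircleDeg1Lift.mul_apply,
      CircleDeg1Lift.mul_apply, unit_le_iff, unit_le_iff, ← unit_le_iff D,
      CircleDeg1Lift.units_apply_inv_apply]
    exact hx
  have hD : ∀ x, y i (y (i + 1) x) = (y i * y (i + 1)) x := fun _ => rfl
  induction hn : l.length using Nat.strong_induction_on generalizing l with
  | _ n ih =>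
  subst hn
  rcases l with _ | ⟨⟨j, ε⟩, l⟩
  · have e : pt y (.mk []) = 0 := by simp [pt, ← FreeGroup.one_eq_mk]
    rw [e]
    have e' : T (.mk []) 0 = 0 := by simp [← FreeGroup.one_eq_mk]
    rw [e']
    refine ⟨le_rfl, h.le_map_map_of_gap i (k := 0) ?_ ?_⟩
    · push_cast; linarith [h.b_lt (i + 1)]
    · push_cast; linarith [h.a_pos i]
  obtain ⟨ihA, ihB⟩ := ih l.length (by simp) hl.tail rfl
  have hbd := h.inReg_bounds (h.inReg_addr hl)
  have hb1 := h.b_lt j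
  have ha0 := h.a_pos j
  have hmk : (FreeGroup.mk ((j, ε) :: l)) = (if ε then .of j else (.of j)⁻¹) * .mk l := by
    cases ε
    · simp [mk_cons_false]
    · simp [mk_cons_true]
  by_cases hj : j = i ∨ j = i + 1
  · have hTe : ∃ e : CircleDeg1Liftˣ, T (if ε then .of j else (.of j)⁻¹) =
        y i * y (i + 1) * e * (y i * y (i + 1))⁻¹ ∧
        FreeGroup.lift y (if ε then .of j else (.of j)⁻¹) = e := by
      rcases hj with rfl | rfl <;> cases ε <;> simp [hTi, hTi', mul_assoc]
    obtain ⟨e, hTe, he⟩ := hTe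
    have hB : T (.mk ((j, ε) :: l)) 0 + 1 ≤ y i (y (i + 1) (pt y (.mk ((j, ε) :: l)))) := by
      rw [hmk, map_mul, Units.val_mul, CircleDeg1Lift.mul_apply, pt_mul, he, hTe, hD]
      exact step _ _ ihB
    refine ⟨?_, hB⟩
    by_cases hs : ∃ l', ((j, ε) :: l) = (i, true) :: (i + 1, true) :: l' ∨
        ((j, ε) :: l) = (i + 1, false) :: (i, false) :: l'
    · have hsp : ∃ l' g, l'.length < ((j, ε) :: l).length ∧ FreeGroup.IsReduced l' ∧
          FreeGroup.mk ((j, ε) :: l) = g * .mk l' ∧ T g = FreeGroup.lift y g := by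
        obtain ⟨l', hs | hs⟩ := hs
        · rw [hs] at hl ⊢
          refine ⟨l', .of i * .of (i + 1), by simp, hl.tail.tail, ?_, ?_⟩
          · rw [mk_cons_true, mk_cons_true, mul_assoc]
          · rw [map_mul, hTi, hTi']
            simp only [map_mul, FreeGroup.lift_apply_of]
            group
        · rw [hs] at hl ⊢
          refine ⟨l', (.of (i + 1))⁻¹ * (.of i)⁻¹, by simp, hl.tail.tail, ?_, ?_⟩
          · rw [mk_cons_false, mk_cons_false, mul_assoc]
          · rw [map_mul, map_inv, map_inv, hTi, hTi']
            simp only [map_mul, map_inv, FreeGroup.lift_apply_of]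
            group
      obtain ⟨l', g, hlen, hr, hg, hTg⟩ := hsp
      rw [hg, pt_mul, map_mul, hTg, Units.val_mul, CircleDeg1Lift.mul_apply, unit_le_iff]
      exact (ih _ hlen hr rfl).1
    · push Not at hs
      suffices y i (y (i + 1) (pt y (.mk ((j, ε) :: l)))) ≤ pt y (.mk ((j, ε) :: l)) + 1 by
        linarith
      have hreg := h.inReg_addr hl
      have hlt := h.b_le_a (Nat.lt_succ_self i)
      have h1 := h.le_b i
      have h2 := h.a_le (i + 1)
      rcases hj with rfl | rfl <;> cases ε
      · exact h.map_map_le_of_mem _ hreg.1 (by linarith [hreg.2])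
      · exact h.map_map_le_of_pos _ hl fun l' hl' => (hs l').1 (by rw [hl'])
      · exact h.map_map_le_of_neg _ hl fun l' hl' => (hs l').2 (by rw [hl'])
      · exact h.map_map_le_of_mem _ (by linarith [hreg.1]) hreg.2
  · push Not at hj
    have hTe : T (if ε then .of j else (.of j)⁻¹) =
        FreeGroup.lift y (if ε then .of j else (.of j)⁻¹) := by
      cases ε <;> simp [hT j hj.1 hj.2]
    have hA : T (.mk ((j, ε) :: l)) 0 ≤ pt y (.mk ((j, ε) :: l)) := by
      rw [hmk, map_mul, Units.val_mul, CircleDeg1Lift.mul_apply, pt_mul, hTe, unit_le_iff]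
      exact ihA
    refine ⟨hA, (add_le_add_left hA 1).trans ?_⟩
    rcases lt_or_ge j i with hji | hji
    · have := h.b_le_a hji
      exact h.le_map_map_of_gap i (k := addr ((j, ε) :: l)) (by linarith [h.b_lt (i + 1)])
        (by linarith)
    · have := h.b_le_a (i := i + 1) (j := j) (by omega)
      refine h.le_map_map_of_gap i (k := addr ((j, ε) :: l) + 1) ?_ ?_
      · push_cast; linarith
      · push_cast; linarith [h.a_pos i]

theorem pt_artin_le (h : PingPong y a c b) (i : ℕ) (w : FreeGroup ℕ) :
    pt y (BraidOrder.artin i w) ≤ pt y w := by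
  have key : pt y (BraidOrder.artin i (BraidOrder.artin i w)) ≤ pt y w := by
    have := (h.pt_artin_artin_aux i
      (T := (FreeGroup.lift y).comp ((artinHom i).comp (artinHom i))) ?_ ?_ ?_
      (FreeGroup.isReduced_toWord (x := w))).1
    · rwa [FreeGroup.mk_toWord] at this
    · intro j h1 h2
      simp [artinHom_of_ne h1 h2]
    · simp only [MonoidHom.comp_apply, artinHom_self, artinHom_succ, map_mul, map_inv,
        FreeGroup.lift_apply_of]
      group
    · simp only [MonoidHom.comp_apply, artinHom_self, artinHom_succ, map_mul, map_inv,
        FreeGroup.lift_apply_of]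
      group
  by_contra hlt
  rw [not_le] at hlt
  exact key.not_gt (hlt.trans_le ((h.pt_artin_le_iff i _ _).2 hlt.le))

theorem pt_artin_of_lt (h : PingPong y a c b) (i : ℕ) :
    pt y (BraidOrder.artin i (.of i)) < pt y (.of i) := by
  rw [artin_apply, artinHom_self, mul_assoc, pt_mul, FreeGroup.lift_apply_of]
  have e : pt y (.of i) = y i 0 := by simp [pt]
  rw [e, pt_mul, FreeGroup.lift_apply_of, ← not_le, unit_le_iff, not_le]
  have e' : y i (pt y (.of i)⁻¹) = 0 := by
    simp [pt]
  have h1 : pt y (.of i)⁻¹ ≤ c (i + 1) - 1 := by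
    have : pt y (.of i)⁻¹ ≤ b i - 1 := by
      rw [← unit_le_iff (y i), e', unit_map_sub_one]
      linarith [h.expand i, h.a_pos i]
    linarith [h.b_le_a (Nat.lt_succ_self i), h.a_le (i + 1)]
  have h2 := (unit_le_iff (y (i + 1))).2 h1
  rw [unit_map_sub_one, h.fix] at h2
  linarith [h.le_b (i + 1), h.b_lt (i + 1)]

end PingPong

namespace PingPong

variable {y : ℕ → CircleDeg1Liftˣ} {a c b : ℕ → ℝ}

theorem pt_nonneg_le (h : PingPong y a c b) {k : ℕ} {p : PresentedGroup (braidRels m)}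
    (hp : p ∈ nonneg m k) : pt y (artinRep m p (.of k)) ≤ pt y (.of k) := by
  induction hp using Submonoid.closure_induction with
  | mem x hx =>
    obtain ⟨i, ⟨_, rfl⟩ | ⟨hi, rfl⟩⟩ := hx
    · rw [artinRep_σ]
      exact h.pt_artin_le _ _
    · have e : artinRep m (σ i) (.of k) = .of k := by
        rw [artinRep_σ, artin_apply, artinHom_of_ne (by omega) (by omega)]
      have e' : artinRep m (σ i)⁻¹ (.of k) = .of k := by
        conv_lhs => rw [← e, ← MulAut.mul_apply, ← map_mul, inv_mul_cancel, map_one,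
          MulAut.one_apply]
      rw [e']
  | one => simp
  | mul p q _ _ hp hq =>
    rw [map_mul, MulAut.mul_apply]
    exact ((h.pt_artinRep_le_iff _ _ _).2 hq).trans hp

theorem pt_pos_lt (h : PingPong y a c b) {k : Fin m} {p : PresentedGroup (braidRels m)}
    (hp : Pos k p) : pt y (artinRep m p (.of k)) < pt y (.of k) := by
  obtain ⟨u, hu, v, hv, rfl⟩ := hp
  rw [map_mul, MulAut.mul_apply]
  refine ((h.pt_artinRep_le_iff _ _ _).2 (h.pt_nonneg_le hv)).trans_lt ?_
  rw [map_mul, MulAut.mul_apply, artinRep_σ]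
  exact ((h.pt_artinRep_lt_iff _ _ _).2 (h.pt_artin_of_lt _)).trans_le (h.pt_nonneg_le hu)

end PingPong

theorem not_pos_one (k : Fin m) : ¬ Pos k 1 := fun hk => by
  obtain ⟨y, a, c, b, h⟩ := exists_pingPong
  simpa using h.pt_pos_lt hk

/-- Conjugates of the Artin generators are positive. -/
theorem exists_pos_conj (i : Fin m) (β : PresentedGroup (braidRels m)) :
    ∃ k, Pos k (β⁻¹ * σ i * β) := by
  obtain ⟨y, a, c, b, h⟩ := exists_pingPong
  rcases eq_one_or_pos not_pos_one (β⁻¹ * σ i * β) with h1 | ⟨k, hk | hk⟩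
  · have hi : σ i = 1 := by
      rw [mul_assoc, inv_mul_eq_one] at h1
      exact (mul_eq_right.1 h1.symm)
    have := h.pt_artin_of_lt i
    rw [← artinRep_σ, hi] at this
    simp at this
  · exact ⟨k, hk⟩
  · have h1 := h.pt_pos_lt hk
    rw [← h.pt_artinRep_lt_iff (β⁻¹ * σ i * β), ← MulAut.mul_apply, ← map_mul, mul_inv_cancel,
      map_one, MulAut.one_apply, ← h.pt_artinRep_lt_iff β, mul_assoc, map_mul, MulAut.mul_apply,
      ← MulAut.mul_apply, ← map_mul, mul_inv_cancel, map_one, MulAut.one_apply, map_mul,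
      MulAut.mul_apply, artinRep_σ] at h1
    exact absurd (h.pt_artin_le i _) h1.not_ge

/-! ## Signed words -/

theorem sig_succ {n : ℕ} (i : Fin (n - 1)) : sig n (i + 1) = σ i := by
  simp [sig, σ]

theorem sEval_append (n : ℕ) (l l' : List (ℕ × Bool)) :
    sEval n (l ++ l') = sEval n l * sEval n l' := by
  simp [sEval]

theorem exists_word_of_nonneg {n k : ℕ} {x : BraidGroup n} (hx : x ∈ nonneg (n - 1) k) :
    ∃ l : List (ℕ × Bool), sEval n l = x ∧ (∀ p ∈ l, k + 1 ≤ p.1 ∧ p.1 ≤ n - 1) ∧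
      (k + 1, false) ∉ l := by
  induction hx using Submonoid.closure_induction with
  | mem x hx =>
    obtain ⟨i, ⟨hi, rfl⟩ | ⟨hi, rfl⟩⟩ := hx
    · refine ⟨[(i + 1, true)], by simp [sEval, sig_succ], ?_, by simp⟩
      simp only [List.mem_singleton, forall_eq]
      omega
    · refine ⟨[(i + 1, false)], by simp [sEval, sig_succ], ?_, ?_⟩
      · simp only [List.mem_singleton, forall_eq]
        omega
      · simp only [List.mem_singleton, Prod.mk.injEq]
        omega
  | one => exact ⟨[], by simp [sEval], by simp, by simp⟩
  | mul x x' _ _ hx hx' =>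
    obtain ⟨l, rfl, h1, h2⟩ := hx
    obtain ⟨l', rfl, h1', h2'⟩ := hx'
    refine ⟨l ++ l', sEval_append n l l', fun p hp => ?_, by simp [h2, h2']⟩
    exact (List.mem_append.1 hp).elim (h1 p) (h1' p)

theorem dehornoyLt_of_pos {n : ℕ} {α β : BraidGroup n} {k : Fin (n - 1)}
    (h : Pos k (α⁻¹ * β)) : dehornoyLt n α β := by
  obtain ⟨a, ha, b, hb, e⟩ := h
  obtain ⟨l, rfl, h1, h2⟩ := exists_word_of_nonneg ha
  obtain ⟨l', rfl, h1', h2'⟩ := exists_word_of_nonneg hb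
  refine ⟨k + 1, by omega, by omega, l ++ ((k : ℕ) + 1, true) :: l', ?_, fun p hp => ?_, ?_,
    by simp⟩
  · rw [e, sEval_append, mul_assoc, ← sig_succ]
    simp [sEval]
  · rcases List.mem_append.1 hp with hp | hp
    · exact h1 p hp
    · rcases List.mem_cons.1 hp with rfl | hp
      · exact ⟨le_rfl, by dsimp only; omega⟩
      · exact h1' p hp
  · simp [h2, h2']

end BraidOrder

/-- The Dehornoy ordering of `B_n` satisfies Property `S`:
`α σ_i β >_D α β >_D α σ_i⁻¹ β` for all `α, β ∈ B_n` and all `1 ≤ i ≤ n-1`. -/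
theorem dehornoy_ordering_has_propertyS (n : ℕ) (hn : 2 ≤ n) :
    ∀ (α β : BraidGroup n) (i : ℕ), 1 ≤ i → i ≤ n - 1 →
      dehornoyLt n (α * β) (α * sig n i * β) ∧
        dehornoyLt n (α * (sig n i)⁻¹ * β) (α * β) := by
  intro α β i hi hin
  obtain ⟨j, rfl⟩ : ∃ j : Fin (n - 1), (j : ℕ) + 1 = i :=
    ⟨⟨i - 1, by omega⟩, by simp only; omega⟩
  obtain ⟨k, hk⟩ := BraidOrder.exists_pos_conj j β
  rw [BraidOrder.sig_succ]
  constructor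
  · refine BraidOrder.dehornoyLt_of_pos (k := k) ?_
    convert hk using 1
    group
  · refine BraidOrder.dehornoyLt_of_pos (k := k) ?_
    convert hk using 1
    group
end
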